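/- Let k ≥ 3 and let H' be a finite connected k-uniform hypergraph that contains no bicycle. Then the edge set of H' admits an edge order e_0,…,e_t with the property that there exists a ∈ {0,…,t} such that e_i is good for all i with a+1 ≤ i ≤ t, and precisely one of the following holds: (i) a = 0; (ii) a ≥ 2 and e_0,…,e_a forms a loose cycle; (iii) a = 1 and e_0,e_1 forms an overlapping pair; (iv) a = 3, k = 3 and e_0,…,e_3 forms a Pasch configuration; (v) a ≥ 3 is odd and e_0,…,e_a forms a (k,(a+1)/2,2)-star; (vi) a ≥ 2 and e_0,…,e_a forms a (k,a+1,d)-link for some d ≤ ⌊k/a⌋. -/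

import Mathlib

variable {V : Type*} [DecidableEq V]

/-! ### Hypergraphs, edge orders, and configurations.
A (finite) hypergraph is represented by its finite set of edges, each edge being a
finite set of vertices; an edge order is a duplicate-free list of edges. -/

/-- The vertex set of a list of edges. -/
def vset (l : List (Finset V)) : Finset V := l.foldr (· ∪ ·) ∅

/-- The set of old vertices of the `i`-th edge of an edge order: those vertices of the
`i`-th edge appearing in some earlier edge. -/
def oldOf (l : List (Finset V)) (i : ℕ) : Finset V := l.getD i ∅ ∩ vset (l.take i)

/-- The `i`-th edge is good: it has exactly one old vertex. -/
def GoodAt (l : List (Finset V)) (i : ℕ) : Prop := (oldOf l i).card = 1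

/-- The `i`-th edge is bad: it has between `2` and `k-1` old vertices. -/
def BadAt (k : ℕ) (l : List (Finset V)) (i : ℕ) : Prop :=
  2 ≤ (oldOf l i).card ∧ (oldOf l i).card ≤ k - 1

/-- The `i`-th edge is `k`-bad: all of its `k` vertices are old. -/
def KBadAt (k : ℕ) (l : List (Finset V)) (i : ℕ) : Prop := (oldOf l i).card = k

/-- An allowed edge order: every non-initial edge is good, bad or `k`-bad, i.e. has at
least one old vertex. -/
def Allowed (l : List (Finset V)) : Prop :=
  l.Nodup ∧ ∀ i, 0 < i → i < l.length → 1 ≤ (oldOf l i).card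

/-- A valid edge order: every non-initial edge is good or bad. -/
def Valid (k : ℕ) (l : List (Finset V)) : Prop :=
  l.Nodup ∧ ∀ i, 0 < i → i < l.length → 1 ≤ (oldOf l i).card ∧ (oldOf l i).card ≤ k - 1

/-- Consecutive edges of the order intersect. -/
def Chain (l : List (Finset V)) : Prop :=
  ∀ i, i + 1 < l.length → (l.getD i ∅ ∩ l.getD (i + 1) ∅).Nonempty

/-- An overlapping pair: two (distinct) edges sharing between `2` and `k-1` vertices. -/
def OverlapPair (k : ℕ) (l : List (Finset V)) : Prop :=
  ∃ e f : Finset V, l = [e, f] ∧ e ≠ f ∧ 2 ≤ (e ∩ f).card ∧ (e ∩ f).card ≤ k - 1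

/-- A loose cycle: at least three edges; cyclically consecutive edges meet in exactly one
vertex and all other pairs of edges are disjoint. -/
def LooseCycle (l : List (Finset V)) : Prop :=
  3 ≤ l.length ∧ l.Nodup ∧
  ∀ i j, i < j → j < l.length →
    (l.getD i ∅ ∩ l.getD j ∅).card =
      if j = i + 1 ∨ (i = 0 ∧ j = l.length - 1) then 1 else 0

/-- A loose path: consecutive edges meet in exactly one vertex and all other pairs of
edges are disjoint. -/
def LoosePath (l : List (Finset V)) : Prop :=
  l ≠ [] ∧ l.Nodup ∧
  ∀ i j, i < j → j < l.length →
    (l.getD i ∅ ∩ l.getD j ∅).card = if j = i + 1 then 1 else 0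

/-- An overlapping pair or a loose cycle. -/
def OPorLC (k : ℕ) (l : List (Finset V)) : Prop := OverlapPair k l ∨ LooseCycle l

/-- A spoiled cycle. -/
def SpoiledCycle (k : ℕ) (l : List (Finset V)) : Prop :=
  Valid k l ∧ Chain l ∧
  ∃ (e₁ e₂ : Finset V) (P₂ : List (Finset V)),
    l = e₁ :: e₂ :: P₂ ∧ OverlapPair k [e₁, e₂] ∧ LoosePath P₂ ∧
    ∃ x y : V, x ≠ y ∧
      vset [e₁, e₂] ∩ vset P₂ = {x, y} ∧
      (e₂ \ e₁) ∩ (P₂.getD 0 ∅ \ (if 2 ≤ P₂.length then P₂.getD 1 ∅ else e₁)) = {x} ∧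
      (e₁ \ e₂) ∩ (P₂.getD (P₂.length - 1) ∅ \
        (if 2 ≤ P₂.length then P₂.getD (P₂.length - 2) ∅ else e₂)) = {y}

/-- A double loose cycle. -/
def DoubleLooseCycle (k : ℕ) (l : List (Finset V)) : Prop :=
  Valid k l ∧ Chain l ∧
  ∃ P₁ P₂ : List (Finset V),
    l = P₁ ++ P₂ ∧ LooseCycle P₁ ∧ LoosePath P₂ ∧ 2 ≤ P₂.length ∧
    ∃ x y : V, x ≠ y ∧
      vset P₁ ∩ vset P₂ = {x, y} ∧
      (P₂.getD 0 ∅ \ P₂.getD 1 ∅) ∩ P₁.getD (P₁.length - 1) ∅ = {x} ∧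
      ∃ a < P₁.length, (P₂.getD (P₂.length - 1) ∅ \ P₂.getD (P₂.length - 2) ∅) ∩
        P₁.getD a ∅ = {y}

/-- A double overlapping pair. -/
def DoubleOverlapPair (k : ℕ) (l : List (Finset V)) : Prop :=
  Valid k l ∧ Chain l ∧
  ∃ e₁ e₂ e₃ e₄ : Finset V,
    l = [e₁, e₂, e₃, e₄] ∧ OverlapPair k [e₁, e₂] ∧ OverlapPair k [e₃, e₄] ∧
    (e₃ ∩ e₄).card ≤ k - 2 ∧
    ∃ x y : V, x ≠ y ∧
      vset [e₁, e₂] ∩ vset [e₃, e₄] = {x, y} ∧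
      (e₁ \ e₂) ∩ (e₄ \ e₃) = {x} ∧ (e₂ \ e₁) ∩ (e₃ \ e₄) = {y}

/-- An overlapping pair/loose cycle with handle. -/
def WithHandle (k : ℕ) (l : List (Finset V)) : Prop :=
  Valid k l ∧ Chain l ∧
  ∃ (l' : List (Finset V)) (e : Finset V),
    l = l' ++ [e] ∧ OPorLC k l' ∧ BadAt k l (l.length - 1)

/-- An overlapping pair/loose cycle to overlapping pair/loose cycle. -/
def CycleToCycle (k : ℕ) (l : List (Finset V)) : Prop :=
  Valid k l ∧ Chain l ∧
  ∃ P₁ P₂ P₃ : List (Finset V),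
    l = P₁ ++ P₂ ++ P₃ ∧ OPorLC k P₁ ∧ OPorLC k P₃ ∧
    ((P₂ = [] ∧ (vset P₁ ∩ vset P₃).card = 1) ∨
     (P₂ ≠ [] ∧ LoosePath P₂ ∧
       (vset P₁ ∩ vset P₂).card = 1 ∧ vset P₁ ∩ vset P₃ = ∅ ∧
       (vset P₂ ∩ vset P₃).card = 1 ∧
       (2 ≤ P₂.length →
         P₂.getD 1 ∅ ∩ vset P₁ = ∅ ∧ P₂.getD (P₂.length - 2) ∅ ∩ vset P₃ = ∅)))

/-- A bicycle. -/
def Bicycle (k : ℕ) (l : List (Finset V)) : Prop :=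
  SpoiledCycle k l ∨ DoubleOverlapPair k l ∨ DoubleLooseCycle k l ∨
    WithHandle k l ∨ CycleToCycle k l

/-- The hypergraph with edge set `E` contains a bicycle: some of its edges, under some
edge order, form one. -/
def ContainsBicycle (k : ℕ) (E : Finset (Finset V)) : Prop :=
  ∃ l : List (Finset V), l.toFinset ⊆ E ∧ Bicycle k l

/-- A Pasch configuration (for `k = 3`): four edges spanning six vertices, each vertex
lying in exactly two of the edges, one vertex for each of the six pairs of edges. -/
def Pasch (l : List (Finset V)) : Prop :=
  Allowed l ∧ l.length = 4 ∧ (vset l).card = 6 ∧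
  (∀ v ∈ vset l, ((Finset.range 4).filter fun i => v ∈ l.getD i ∅).card = 2) ∧
  ∀ i j, i < j → j < 4 → (l.getD i ∅ ∩ l.getD j ∅).card = 1

/-- A loose star with centre `c`: edges pairwise disjoint except for the common central
vertex `c`. -/
def LooseStar (l : List (Finset V)) (c : V) : Prop :=
  l ≠ [] ∧ l.Nodup ∧ (∀ e ∈ l, c ∈ e) ∧
  ∀ i j, i < j → j < l.length → l.getD i ∅ ∩ l.getD j ∅ = {c}

/-- A `(k,u,2)`-star: `2u` edges forming two loose `u`-stars whose edges are matched up so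
that matched edges share all their vertices except the two centres. -/
def StarKU2 (k u : ℕ) (l : List (Finset V)) : Prop :=
  Allowed l ∧ l.length = 2 * u ∧
  ∃ (c₁ c₂ : V) (l₁ l₂ : List (Finset V)),
    c₁ ≠ c₂ ∧ l₁.length = u ∧ l₂.length = u ∧
    (l₁ ++ l₂).Perm l ∧ LooseStar l₁ c₁ ∧ LooseStar l₂ c₂ ∧
    ∀ i < u, (l₁.getD i ∅).erase c₁ = (l₂.getD i ∅).erase c₂

/-- A `(k,u,a)`-link: `u` edges spanning `k+a` vertices, any two of which together contain
all `k+a` vertices. -/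
def KLink (k u a : ℕ) (l : List (Finset V)) : Prop :=
  Allowed l ∧ l.length = u ∧ (vset l).card = k + a ∧
  ∀ i j, i < j → j < u → (l.getD i ∅ ∪ l.getD j ∅).card = k + a

/-- The hypergraph with edge set `E` is connected. -/
def HyperConnected (E : Finset (Finset V)) : Prop :=
  ∀ F ⊆ E, F.Nonempty → (E \ F).Nonempty → ∃ e ∈ F, ∃ f ∈ E \ F, (e ∩ f).Nonempty

/-- The hypergraph with edge set `E` is `k`-uniform. -/
def Uniform (k : ℕ) (E : Finset (Finset V)) : Prop := ∀ e ∈ E, e.card = k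


set_option linter.unusedSectionVars false

theorem mem_vset {l : List (Finset V)} {x : V} : x ∈ vset l ↔ ∃ e ∈ l, x ∈ e := by
  induction l with
  | nil => simp [vset]
  | cons a l ih =>
    have : vset (a :: l) = a ∪ vset l := rfl
    rw [this, Finset.mem_union, ih]; simp

theorem vset_append (l₁ l₂ : List (Finset V)) : vset (l₁ ++ l₂) = vset l₁ ∪ vset l₂ := by
  ext x; simp only [mem_vset, Finset.mem_union, List.mem_append]
  constructor
  · rintro ⟨e, h | h, hx⟩
    · exact Or.inl ⟨e, h, hx⟩
    · exact Or.inr ⟨e, h, hx⟩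
  · rintro (⟨e, h, hx⟩ | ⟨e, h, hx⟩)
    · exact ⟨e, Or.inl h, hx⟩
    · exact ⟨e, Or.inr h, hx⟩

theorem vset_cons (e : Finset V) (l : List (Finset V)) : vset (e :: l) = e ∪ vset l := rfl

theorem vset_nil : vset ([] : List (Finset V)) = ∅ := rfl

theorem vset_perm {l l' : List (Finset V)} (h : l.Perm l') : vset l = vset l' := by
  ext x; simp only [mem_vset, h.mem_iff]

theorem subset_vset {l : List (Finset V)} {e : Finset V} (h : e ∈ l) : e ⊆ vset l :=
  fun _ hx => mem_vset.2 ⟨e, h, hx⟩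

theorem getD_mem_of_lt {l : List (Finset V)} {i : ℕ} (h : i < l.length) : l.getD i ∅ ∈ l := by
  rw [List.getD_eq_getElem _ _ h]; exact List.getElem_mem h

theorem exists_getD_of_mem {l : List (Finset V)} {e : Finset V} (h : e ∈ l) :
    ∃ i < l.length, l.getD i ∅ = e := by
  obtain ⟨i, hi, h⟩ := List.mem_iff_getElem.1 h
  exact ⟨i, hi, by rw [List.getD_eq_getElem _ _ hi]; exact h⟩

theorem mem_vset_getD {l : List (Finset V)} {x : V} :
    x ∈ vset l ↔ ∃ i < l.length, x ∈ l.getD i ∅ := by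
  rw [mem_vset]
  constructor
  · rintro ⟨e, he, hx⟩
    obtain ⟨i, hi, rfl⟩ := exists_getD_of_mem he
    exact ⟨i, hi, hx⟩
  · rintro ⟨i, hi, hx⟩
    exact ⟨_, getD_mem_of_lt hi, hx⟩

theorem mem_vset_take {l : List (Finset V)} {x : V} {i : ℕ} :
    x ∈ vset (l.take i) ↔ ∃ j < i, j < l.length ∧ x ∈ l.getD j ∅ := by
  rw [mem_vset_getD]
  constructor
  · rintro ⟨j, hj, hx⟩
    rw [List.length_take] at hj
    have h1 : j < i := by omega
    have h2 : j < l.length := by omega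
    refine ⟨j, h1, h2, ?_⟩
    rw [List.getD_eq_getElem _ _ (by rw [List.length_take]; omega)] at hx
    rw [List.getD_eq_getElem _ _ h2]
    simpa using hx
  · rintro ⟨j, h1, h2, hx⟩
    have h3 : j < (l.take i).length := by rw [List.length_take]; omega
    refine ⟨j, h3, ?_⟩
    rw [List.getD_eq_getElem _ _ h3]
    rw [List.getD_eq_getElem _ _ h2] at hx
    simpa using hx

theorem mem_oldOf {l : List (Finset V)} {x : V} {i : ℕ} :
    x ∈ oldOf l i ↔ x ∈ l.getD i ∅ ∧ ∃ j < i, j < l.length ∧ x ∈ l.getD j ∅ := by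
  rw [oldOf, Finset.mem_inter, mem_vset_take]

theorem oldOf_append_left {l₁ l₂ : List (Finset V)} {i : ℕ} (h : i < l₁.length) :
    oldOf (l₁ ++ l₂) i = oldOf l₁ i := by
  rw [oldOf, oldOf, List.getD_append _ _ _ _ h, List.take_append_of_le_length h.le]

theorem oldOf_append_right {l₁ l₂ : List (Finset V)} {i : ℕ} :
    oldOf (l₁ ++ l₂) (l₁.length + i) = l₂.getD i ∅ ∩ (vset l₁ ∪ vset (l₂.take i)) := by
  rw [oldOf, List.getD_append_right _ _ _ _ (by omega), List.take_append, vset_append,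
    List.take_of_length_le (by omega)]
  simp

theorem chain_append {l₁ l₂ : List (Finset V)} (h₁ : Chain l₁) (h₂ : Chain l₂)
    (h : l₁ ≠ [] → l₂ ≠ [] → (l₁.getD (l₁.length - 1) ∅ ∩ l₂.getD 0 ∅).Nonempty) :
    Chain (l₁ ++ l₂) := by
  intro i hi
  rw [List.length_append] at hi
  by_cases a : i + 1 < l₁.length
  · rw [List.getD_append _ _ _ _ a, List.getD_append _ _ _ _ (by omega)]
    exact h₁ i a
  · by_cases b : i + 1 = l₁.length
    · rw [List.getD_append _ _ _ _ (by omega), List.getD_append_right _ _ _ _ (by omega)]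
      have : i = l₁.length - 1 := by omega
      have h3 : i + 1 - l₁.length = 0 := by omega
      rw [h3, this]
      apply h
      · rintro rfl; simp at b
      · rintro rfl; simp at hi; omega
    · rw [List.getD_append_right _ _ _ _ (by omega), List.getD_append_right _ _ _ _ (by omega)]
      have h3 : i + 1 - l₁.length = (i - l₁.length) + 1 := by omega
      rw [h3]
      exact h₂ _ (by omega)

theorem valid_append {k : ℕ} {l₁ l₂ : List (Finset V)} (h₁ : Valid k l₁) (h₂ : Valid k l₂)
    (hd : ∀ e ∈ l₁, e ∉ l₂)
    (hs : vset l₁ ∩ vset l₂ ⊆ l₂.getD 0 ∅)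
    (hlo : 1 ≤ (l₂.getD 0 ∅ ∩ vset l₁).card) (hhi : (l₂.getD 0 ∅ ∩ vset l₁).card ≤ k - 1) :
    Valid k (l₁ ++ l₂) := by
  refine ⟨List.nodup_append'.2 ⟨h₁.1, h₂.1, fun e he he' => hd e he he'⟩, ?_⟩
  intro i hi hi'
  rw [List.length_append] at hi'
  by_cases a : i < l₁.length
  · rw [oldOf_append_left a]; exact h₁.2 i hi a
  · obtain ⟨j, rfl⟩ : ∃ j, i = l₁.length + j := ⟨i - l₁.length, by omega⟩
    rw [oldOf_append_right]
    by_cases b : j = 0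
    · subst b
      rw [List.take_zero, vset_nil, Finset.union_empty]
      exact ⟨hlo, hhi⟩
    · have : l₂.getD j ∅ ∩ (vset l₁ ∪ vset (l₂.take j)) = oldOf l₂ j := by
        ext x
        rw [oldOf, Finset.mem_inter, Finset.mem_union, Finset.mem_inter]
        constructor
        · rintro ⟨h, h' | h'⟩
          · refine ⟨h, mem_vset_take.2 ⟨0, by omega, by omega, hs ?_⟩⟩
            exact Finset.mem_inter.2 ⟨h', mem_vset_getD.2 ⟨j, by omega, h⟩⟩
          · exact ⟨h, h'⟩
        · rintro ⟨h, h'⟩; exact ⟨h, Or.inr h'⟩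
      rw [this]
      exact h₂.2 j (by omega) (by omega)

theorem disj_of_card {k : ℕ} {l₁ l₂ : List (Finset V)} (hu : ∀ e ∈ l₁, e.card = k)
    (h : (vset l₁ ∩ vset l₂).card < k) : ∀ e ∈ l₁, e ∉ l₂ := by
  intro e he he'
  have := Finset.card_le_card (Finset.subset_inter (subset_vset he) (subset_vset he'))
  rw [hu e he] at this
  omega

theorem valid_singleton (k : ℕ) (e : Finset V) : Valid k [e] := by
  refine ⟨by simp, ?_⟩
  intro i h1 h2; simp at h2; omega

theorem chain_singleton (e : Finset V) : Chain [e] := by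
  intro i h1; simp at h1

theorem valid_snoc {k : ℕ} {l : List (Finset V)} {e : Finset V} (h₁ : Valid k l)
    (he : e ∉ l) (hlo : 1 ≤ (e ∩ vset l).card) (hhi : (e ∩ vset l).card ≤ k - 1) :
    Valid k (l ++ [e]) := by
  apply valid_append h₁ (valid_singleton k e)
  · intro f hf hf'; simp at hf'; subst hf'; exact he hf
  · intro x hx; simpa [vset_cons, vset_nil] using (Finset.mem_inter.1 hx).2
  · simpa using hlo
  · simpa using hhi

theorem chain_snoc {l : List (Finset V)} {e : Finset V} (h₁ : Chain l)
    (h : l ≠ [] → (l.getD (l.length - 1) ∅ ∩ e).Nonempty) : Chain (l ++ [e]) := by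
  apply chain_append h₁ (chain_singleton e)
  intro a _; simpa using h a

theorem LooseCycle.chain {l : List (Finset V)} (h : LooseCycle l) : Chain l := by
  intro i hi
  have := h.2.2 i (i+1) (by omega) hi
  rw [if_pos (Or.inl rfl)] at this
  rw [← Finset.card_pos]; omega

theorem LoosePath.chain {l : List (Finset V)} (h : LoosePath l) : Chain l := by
  intro i hi
  have := h.2.2 i (i+1) (by omega) hi
  rw [if_pos rfl] at this
  rw [← Finset.card_pos]; omega

theorem chain_old {l : List (Finset V)} (h : Chain l) (i : ℕ) (h0 : 0 < i) (hi : i < l.length) :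
    1 ≤ (oldOf l i).card := by
  obtain ⟨x, hx⟩ := h (i-1) (by omega)
  rw [Finset.mem_inter, Nat.sub_add_cancel h0] at hx
  exact Finset.card_pos.2 ⟨x, mem_oldOf.2 ⟨hx.2, i-1, by omega, by omega, hx.1⟩⟩

theorem LooseCycle.valid {k : ℕ} (hk : 3 ≤ k) {l : List (Finset V)} (h : LooseCycle l) :
    Valid k l := by
  refine ⟨h.2.1, fun i h0 hi => ⟨chain_old h.chain i h0 hi, ?_⟩⟩
  have hsub : oldOf l i ⊆ (l.getD (i-1) ∅ ∩ l.getD i ∅) ∪ (l.getD 0 ∅ ∩ l.getD i ∅) := by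
    intro x hx
    obtain ⟨h1, j, hj, hjl, h2⟩ := mem_oldOf.1 hx
    have := h.2.2 j i hj hi
    split_ifs at this with hc
    · rw [Finset.mem_union, Finset.mem_inter, Finset.mem_inter]
      rcases hc with hc | hc
      · have : i - 1 = j := by omega
        rw [this]; exact Or.inl ⟨h2, h1⟩
      · rw [hc.1] at h2; exact Or.inr ⟨h2, h1⟩
    · rw [Finset.card_eq_zero] at this
      have h3 : x ∈ l.getD j ∅ ∩ l.getD i ∅ := Finset.mem_inter.2 ⟨h2, h1⟩
      rw [this] at h3; simp at h3
  have h1 := h.2.2 (i-1) i (by omega) hi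
  have h2 := h.2.2 0 i (by omega) hi
  have h3 := Finset.card_le_card hsub
  have h4 := Finset.card_union_le (l.getD (i-1) ∅ ∩ l.getD i ∅) (l.getD 0 ∅ ∩ l.getD i ∅)
  split_ifs at h1 h2 <;> omega

theorem LoosePath.valid {k : ℕ} (hk : 3 ≤ k) {l : List (Finset V)} (h : LoosePath l) :
    Valid k l := by
  refine ⟨h.2.1, fun i h0 hi => ⟨chain_old h.chain i h0 hi, ?_⟩⟩
  have hsub : oldOf l i ⊆ (l.getD (i-1) ∅ ∩ l.getD i ∅) := by
    intro x hx
    obtain ⟨h1, j, hj, hjl, h2⟩ := mem_oldOf.1 hx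
    have := h.2.2 j i hj hi
    split_ifs at this with hc
    · have : i - 1 = j := by omega
      rw [Finset.mem_inter, this]; exact ⟨h2, h1⟩
    · rw [Finset.card_eq_zero] at this
      have h3 : x ∈ l.getD j ∅ ∩ l.getD i ∅ := Finset.mem_inter.2 ⟨h2, h1⟩
      rw [this] at h3; simp at h3
  have h1 := h.2.2 (i-1) i (by omega) hi
  have h3 := Finset.card_le_card hsub
  split_ifs at h1 <;> omega

theorem overlapPair_iff {k : ℕ} {e f : Finset V} :
    OverlapPair k [e, f] ↔ e ≠ f ∧ 2 ≤ (e ∩ f).card ∧ (e ∩ f).card ≤ k - 1 := by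
  constructor
  · rintro ⟨a, b, h, h'⟩
    simp only [List.cons.injEq, and_true] at h
    obtain ⟨rfl, rfl⟩ := h
    exact h'
  · intro h; exact ⟨e, f, rfl, h⟩

theorem OverlapPair.chain {k : ℕ} {l : List (Finset V)} (h : OverlapPair k l) : Chain l := by
  obtain ⟨e, f, rfl, h1, h2, h3⟩ := h
  apply chain_snoc (l := [e]) (chain_singleton e)
  intro _
  simp only [List.length_singleton, Nat.sub_self, List.getD_cons_zero]
  rw [← Finset.card_pos]; omega

theorem OverlapPair.valid {k : ℕ} {l : List (Finset V)} (h : OverlapPair k l) : Valid k l := by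
  obtain ⟨e, f, rfl, h1, h2, h3⟩ := h
  apply valid_snoc (l := [e]) (valid_singleton k e)
  · simpa using h1.symm
  · simp only [vset_cons, vset_nil, Finset.union_empty]; rw [Finset.inter_comm]; omega
  · simp only [vset_cons, vset_nil, Finset.union_empty]; rw [Finset.inter_comm]; omega

theorem OPorLC.valid {k : ℕ} (hk : 3 ≤ k) {l : List (Finset V)} (h : OPorLC k l) : Valid k l :=
  h.elim (fun h => h.valid) (fun h => h.valid hk)

theorem OPorLC.chain {k : ℕ} {l : List (Finset V)} (h : OPorLC k l) : Chain l :=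
  h.elim (fun h => h.chain) (fun h => h.chain)

theorem OPorLC.ne_nil {k : ℕ} {l : List (Finset V)} (h : OPorLC k l) : l ≠ [] := by
  rcases h with ⟨e, f, rfl, _⟩ | h
  · simp
  · rintro rfl; have := h.1; simp at this

theorem OPorLC.rotate_one {k : ℕ} {l : List (Finset V)} {e : Finset V} (h : OPorLC k (e :: l)) :
    OPorLC k (l ++ [e]) := by
  rcases h with ⟨a, b, h, h1, h2, h3⟩ | ⟨h1, h2, h3⟩
  · simp only [List.cons.injEq] at h
    obtain ⟨rfl, rfl⟩ := h
    refine Or.inl ⟨b, e, rfl, h1.symm, ?_⟩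
    rw [Finset.inter_comm]; exact ⟨h2, h3⟩
  · refine Or.inr ⟨by simpa using h1, ?_, ?_⟩
    · exact (List.perm_append_singleton e l).nodup_iff.2 h2
    · intro i j hij hj
      rw [List.length_append, List.length_singleton] at hj ⊢
      rw [List.length_cons] at h3 h1
      rw [List.getD_append _ _ _ _ (by omega)]
      by_cases a : j < l.length
      · rw [List.getD_append _ _ _ _ a]
        have := h3 (i+1) (j+1) (by omega) (by omega)
        rw [List.getD_cons_succ, List.getD_cons_succ] at this
        rw [this]
        congr 1
        rw [eq_iff_iff]
        omega
      · rw [List.getD_append_right _ _ _ _ (by omega)]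
        have : j - l.length = 0 := by omega
        rw [this, List.getD_cons_zero]
        have := h3 0 (i+1) (by omega) (by omega)
        rw [List.getD_cons_succ, List.getD_cons_zero, Finset.inter_comm] at this
        rw [this]
        congr 1
        rw [eq_iff_iff]
        omega

theorem OPorLC.rot_head {k : ℕ} {l : List (Finset V)} {e : Finset V} (h : OPorLC k l)
    (he : e ∈ l) : ∃ l', (e :: l').Perm l ∧ OPorLC k (e :: l') := by
  obtain ⟨s, t, rfl⟩ := List.append_of_mem he
  have key : ∀ (s r : List (Finset V)), OPorLC k (s ++ r) → OPorLC k (r ++ s) := by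
    intro s
    induction s with
    | nil => intro r h; simpa using h
    | cons a s ih =>
      intro r h
      have h1 : OPorLC k ((s ++ r) ++ [a]) := OPorLC.rotate_one (by simpa using h)
      rw [List.append_assoc] at h1
      have := ih _ h1
      simpa using this
  exact ⟨t ++ s, List.perm_append_comm (l₁ := e :: t), key _ _ h⟩

theorem OPorLC.rot_last {k : ℕ} {l : List (Finset V)} {e : Finset V} (h : OPorLC k l)
    (he : e ∈ l) : ∃ l', (l' ++ [e]).Perm l ∧ OPorLC k (l' ++ [e]) := by
  obtain ⟨l', h1, h2⟩ := h.rot_head he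
  exact ⟨l', (List.perm_append_singleton e l').trans h1, h2.rotate_one⟩

theorem LooseCycle.rot_last {l : List (Finset V)} {e : Finset V} (h : LooseCycle l)
    (he : e ∈ l) : ∃ l', (l' ++ [e]).Perm l ∧ LooseCycle (l' ++ [e]) := by
  obtain ⟨l', h1, h2⟩ := OPorLC.rot_last (k := 3) (Or.inr h) he
  refine ⟨l', h1, ?_⟩
  rcases h2 with ⟨a, b, h2, _⟩ | h2
  · have := h.1
    rw [← h1.length_eq, h2] at this
    simp at this
  · exact h2

set_option linter.unusedSectionVars false

/-- The standing hypotheses. -/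
structure BF (k : ℕ) (E : Finset (Finset V)) : Prop where
  hk : 3 ≤ k
  hu : Uniform k E
  hc : HyperConnected E
  hb : ¬ ContainsBicycle k E

theorem BF.handle {k : ℕ} {E : Finset (Finset V)} (H : BF k E) {l : List (Finset V)}
    (hl : OPorLC k l) (hlE : ∀ e ∈ l, e ∈ E) {g : Finset V} (hg : g ∈ E) (hgl : g ∉ l)
    (h2 : 2 ≤ (g ∩ vset l).card) : g ⊆ vset l := by
  by_contra hcon
  obtain ⟨x, hx⟩ : (g ∩ vset l).Nonempty := Finset.card_pos.1 (by omega)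
  rw [Finset.mem_inter] at hx
  obtain ⟨e, he, hxe⟩ := mem_vset.1 hx.2
  obtain ⟨l', hp, ho⟩ := hl.rot_last he
  have hv : vset (l' ++ [e]) = vset l := vset_perm hp
  have hlt : (g ∩ vset l).card ≤ k - 1 := by
    have h1 : (g ∩ vset l).card < g.card := by
      apply Finset.card_lt_card
      refine ⟨Finset.inter_subset_left, fun h => hcon ?_⟩
      intro y hy; exact (Finset.mem_inter.1 (h hy)).2
    rw [H.hu g hg] at h1; omega
  apply H.hb
  refine ⟨(l' ++ [e]) ++ [g], ?_, Or.inr (Or.inr (Or.inr (Or.inl ⟨?_, ?_, l' ++ [e], g, rfl, ho, ?_⟩)))⟩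
  · intro a ha
    rw [List.mem_toFinset, List.mem_append, hp.mem_iff] at ha
    rcases ha with ha | ha
    · exact hlE a ha
    · simp at ha; rw [ha]; exact hg
  · apply valid_snoc (ho.valid H.hk)
    · rwa [hp.mem_iff]
    · rw [hv]; omega
    · rw [hv]; exact hlt
  · apply chain_snoc ho.chain
    intro _
    refine ⟨x, Finset.mem_inter.2 ⟨?_, hx.1⟩⟩
    rw [List.getD_append_right _ _ _ _ (by simp)]
    simpa using hxe
  · have : ((l' ++ [e]) ++ [g]).length - 1 = (l' ++ [e]).length + 0 := by simp
    rw [BadAt, this, oldOf_append_right, hv]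
    simp only [List.getD_cons_zero, List.take_zero, vset_nil, Finset.union_empty]
    exact ⟨h2, hlt⟩

theorem inter_card_lt {k : ℕ} {e f : Finset V} (he : e.card = k) (hf : f.card = k) (hne : e ≠ f) :
    (e ∩ f).card ≤ k - 1 := by
  have h : (e ∩ f).card < e.card := by
    apply Finset.card_lt_card
    refine ⟨Finset.inter_subset_left, fun h => hne ?_⟩
    apply Finset.eq_of_subset_of_card_le
    · intro y hy; exact (Finset.mem_inter.1 (h hy)).2
    · omega
  omega

/-- Overlapping pair inside `E`. -/
def IsOP (E : Finset (Finset V)) (e f : Finset V) : Prop :=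
  e ∈ E ∧ f ∈ E ∧ e ≠ f ∧ 2 ≤ (e ∩ f).card

theorem IsOP.symm {E : Finset (Finset V)} {e f : Finset V} (h : IsOP E e f) : IsOP E f e :=
  ⟨h.2.1, h.1, h.2.2.1.symm, by rw [Finset.inter_comm]; exact h.2.2.2⟩

theorem BF.overlapPair {k : ℕ} {E : Finset (Finset V)} (H : BF k E) {e f : Finset V}
    (h : IsOP E e f) : OverlapPair k [e, f] :=
  overlapPair_iff.2 ⟨h.2.2.1, h.2.2.2, inter_card_lt (H.hu _ h.1) (H.hu _ h.2.1) h.2.2.1⟩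

theorem vset_pair (e f : Finset V) : vset [e, f] = e ∪ f := by
  simp [vset_cons, vset_nil]

theorem BF.op_handle {k : ℕ} {E : Finset (Finset V)} (H : BF k E) {e f g : Finset V}
    (h : IsOP E e f) (hg : g ∈ E) (h2 : 2 ≤ (g ∩ (e ∪ f)).card) : g ⊆ e ∪ f := by
  by_cases he : g = e
  · subst he; exact Finset.subset_union_left
  by_cases hf : g = f
  · subst hf; exact Finset.subset_union_right
  rw [← vset_pair] at h2 ⊢
  apply H.handle (Or.inl (H.overlapPair h)) _ hg _ h2
  · intro a ha; simp at ha; rcases ha with rfl | rfl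
    · exact h.1
    · exact h.2.1
  · simp [he, hf]

/-- A loose path with both end vertices `x ≠ y` on `U` and nothing else on `U`. -/
def PathOn (U : Finset V) (P : List (Finset V)) (x y : V) : Prop :=
  LoosePath P ∧ 2 ≤ P.length ∧ x ≠ y ∧ P.getD 0 ∅ ∩ U = {x} ∧ P.getD (P.length - 1) ∅ ∩ U = {y} ∧
    ∀ i, 0 < i → i + 1 < P.length → P.getD i ∅ ∩ U = ∅

theorem mem_of_inter_eq_singleton {A B : Finset V} {x : V} (h : A ∩ B = {x}) : x ∈ A ∧ x ∈ B := by
  have : x ∈ A ∩ B := by rw [h]; simp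
  exact Finset.mem_inter.1 this

theorem eq_of_inter_eq_singleton {A B : Finset V} {x z : V} (h : A ∩ B = {x}) (ha : z ∈ A)
    (hb : z ∈ B) : z = x := by
  have : z ∈ A ∩ B := Finset.mem_inter.2 ⟨ha, hb⟩
  rw [h] at this; simpa using this

theorem not_of_inter_eq_empty {A B : Finset V} {z : V} (h : A ∩ B = ∅) (ha : z ∈ A)
    (hb : z ∈ B) : False := by
  have : z ∈ A ∩ B := Finset.mem_inter.2 ⟨ha, hb⟩
  rw [h] at this; simp at this

theorem PathOn.reverse_aux {U : Finset V} {P : List (Finset V)} {x y : V} (h : PathOn U P x y)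
    {i : ℕ} {z : V} (hz : z ∈ P.getD i ∅) (hU : z ∈ U) (hi : i < P.length) :
    (i = 0 ∧ z = x) ∨ (i = P.length - 1 ∧ z = y) := by
  obtain ⟨h1, h2, h3, h4, h5, h6⟩ := h
  by_cases a : i = 0
  · subst a; exact Or.inl ⟨rfl, eq_of_inter_eq_singleton h4 hz hU⟩
  · by_cases b : i = P.length - 1
    · subst b; exact Or.inr ⟨rfl, eq_of_inter_eq_singleton h5 hz hU⟩
    · exact (not_of_inter_eq_empty (h6 i (by omega) (by omega)) hz hU).elim

theorem PathOn.inter {U : Finset V} {P : List (Finset V)} {x y : V} (h : PathOn U P x y) :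
    U ∩ vset P = {x, y} := by
  ext z
  rw [Finset.mem_inter, mem_vset_getD, Finset.mem_insert, Finset.mem_singleton]
  constructor
  · rintro ⟨hU, i, hi, hz⟩
    rcases h.reverse_aux hz hU hi with a | a
    · exact Or.inl a.2
    · exact Or.inr a.2
  · obtain ⟨h1, h2, h3, h4, h5, h6⟩ := h
    rintro (rfl | rfl)
    · have := mem_of_inter_eq_singleton h4
      exact ⟨this.2, 0, by omega, this.1⟩
    · have := mem_of_inter_eq_singleton h5
      exact ⟨this.2, P.length - 1, by omega, this.1⟩

theorem PathOn.x_not {U : Finset V} {P : List (Finset V)} {x y : V} (h : PathOn U P x y) :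
    x ∉ P.getD 1 ∅ := by
  intro hx
  have hU := (mem_of_inter_eq_singleton h.2.2.2.1).2
  have := h.2.1
  rcases h.reverse_aux hx hU (by omega) with a | a
  · omega
  · exact h.2.2.1 a.2

theorem PathOn.y_not {U : Finset V} {P : List (Finset V)} {x y : V} (h : PathOn U P x y) :
    y ∉ P.getD (P.length - 2) ∅ := by
  intro hx
  have hU := (mem_of_inter_eq_singleton h.2.2.2.2.1).2
  have := h.2.1
  rcases h.reverse_aux hx hU (by omega) with a | a
  · exact h.2.2.1 a.2.symm
  · omega

theorem PathOn.mono {U U' : Finset V} {P : List (Finset V)} {x y : V} (h : PathOn U P x y)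
    (hs : U' ⊆ U) (hx : x ∈ U') (hy : y ∈ U') : PathOn U' P x y := by
  obtain ⟨h1, h2, h3, h4, h5, h6⟩ := h
  refine ⟨h1, h2, h3, ?_, ?_, ?_⟩
  · apply Finset.Subset.antisymm
    · rw [← h4]; exact Finset.inter_subset_inter_left hs
    · rw [Finset.singleton_subset_iff, Finset.mem_inter]
      exact ⟨(mem_of_inter_eq_singleton h4).1, hx⟩
  · apply Finset.Subset.antisymm
    · rw [← h5]; exact Finset.inter_subset_inter_left hs
    · rw [Finset.singleton_subset_iff, Finset.mem_inter]
      exact ⟨(mem_of_inter_eq_singleton h5).1, hy⟩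
  · intro i a b
    exact Finset.subset_empty.1 ((Finset.inter_subset_inter_left hs).trans (h6 i a b).subset)

theorem LoosePath.old_le_one {l : List (Finset V)} (h : LoosePath l) {i : ℕ} (h0 : 0 < i)
    (hi : i < l.length) : (oldOf l i).card ≤ 1 := by
  have hsub : oldOf l i ⊆ (l.getD (i-1) ∅ ∩ l.getD i ∅) := by
    intro x hx
    obtain ⟨h1, j, hj, hjl, h2⟩ := mem_oldOf.1 hx
    have := h.2.2 j i hj hi
    split_ifs at this with hc
    · have : i - 1 = j := by omega
      rw [Finset.mem_inter, this]; exact ⟨h2, h1⟩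
    · rw [Finset.card_eq_zero] at this
      exact (not_of_inter_eq_empty this h2 h1).elim
  have h1 := h.2.2 (i-1) i (by omega) hi
  have h3 := Finset.card_le_card hsub
  split_ifs at h1 <;> omega

theorem PathOn.valid {k : ℕ} (hk : 3 ≤ k) {X P : List (Finset V)} {x y : V} (hX : Valid k X)
    (h : PathOn (vset X) P x y) (hu : ∀ e ∈ X, e.card = k) : Valid k (X ++ P) := by
  have hd : ∀ e ∈ X, e ∉ P := by
    apply disj_of_card hu
    rw [h.inter]
    have := Finset.card_le_two (a := x) (b := y)
    omega
  refine ⟨List.nodup_append'.2 ⟨hX.1, h.1.2.1, fun e he he' => hd e he he'⟩, ?_⟩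
  intro i hi hi'
  rw [List.length_append] at hi'
  by_cases a : i < X.length
  · rw [oldOf_append_left a]; exact hX.2 i hi a
  · obtain ⟨j, rfl⟩ : ∃ j, i = X.length + j := ⟨i - X.length, by omega⟩
    rw [oldOf_append_right, Finset.inter_union_distrib_left]
    have h1 : (P.getD j ∅ ∩ vset X).card ≤ 1 := by
      obtain ⟨h1, h2, h3, h4, h5, h6⟩ := h
      by_cases a : j = 0
      · subst a; rw [h4]; simp
      · by_cases b : j = P.length - 1
        · subst b; rw [h5]; simp
        · rw [h6 j (by omega) (by omega)]; simp
    have h2 : (P.getD j ∅ ∩ vset (P.take j)).card ≤ 1 := by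
      by_cases a : j = 0
      · subst a; simp [vset_nil]
      · exact h.1.old_le_one (by omega) (by omega)
    have h3 := Finset.card_union_le (P.getD j ∅ ∩ vset X) (P.getD j ∅ ∩ vset (P.take j))
    refine ⟨?_, by omega⟩
    by_cases a : j = 0
    · subst a
      rw [h.2.2.2.1]
      exact Finset.card_pos.2 ⟨x, by simp⟩
    · have h4 := chain_old h.1.chain j (by omega) (by omega)
      rw [oldOf] at h4
      have h5 := Finset.card_le_card
        (Finset.subset_union_right (s₁ := P.getD j ∅ ∩ vset X) (s₂ := P.getD j ∅ ∩ vset (P.take j)))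
      omega

theorem BF.no_spoiled {k : ℕ} {E : Finset (Finset V)} (H : BF k E) {e f : Finset V}
    (h : IsOP E e f) {P : List (Finset V)} (hP : ∀ p ∈ P, p ∈ E) {x y : V}
    (hp : PathOn (e ∪ f) P x y) (hx : x ∈ f \ e) (hy : y ∈ e \ f) : False := by
  rw [← vset_pair] at hp
  have hlen := hp.2.1
  apply H.hb
  refine ⟨[e, f] ++ P, ?_, Or.inl ⟨?_, ?_, e, f, P, rfl, H.overlapPair h, hp.1, x, y, hp.2.2.1,
    hp.inter, ?_, ?_⟩⟩
  · intro a ha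
    simp at ha
    rcases ha with rfl | rfl | ha
    · exact h.1
    · exact h.2.1
    · exact hP _ ha
  · apply PathOn.valid H.hk (H.overlapPair h).valid hp
    intro a ha; simp at ha; rcases ha with rfl | rfl
    · exact H.hu _ h.1
    · exact H.hu _ h.2.1
  · apply chain_append (H.overlapPair h).chain hp.1.chain
    intro _ _
    refine ⟨x, Finset.mem_inter.2 ⟨?_, (mem_of_inter_eq_singleton hp.2.2.2.1).1⟩⟩
    simpa using (Finset.mem_sdiff.1 hx).1
  · rw [if_pos hlen]
    ext z
    rw [Finset.mem_inter, Finset.mem_singleton]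
    constructor
    · rintro ⟨h1, h2⟩
      apply eq_of_inter_eq_singleton hp.2.2.2.1 (Finset.mem_sdiff.1 h2).1
      rw [vset_pair]; exact Finset.mem_union_right _ (Finset.mem_sdiff.1 h1).1
    · rintro rfl
      exact ⟨hx, Finset.mem_sdiff.2 ⟨(mem_of_inter_eq_singleton hp.2.2.2.1).1, hp.x_not⟩⟩
  · rw [if_pos hlen]
    ext z
    rw [Finset.mem_inter, Finset.mem_singleton]
    constructor
    · rintro ⟨h1, h2⟩
      apply eq_of_inter_eq_singleton hp.2.2.2.2.1 (Finset.mem_sdiff.1 h2).1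
      rw [vset_pair]; exact Finset.mem_union_left _ (Finset.mem_sdiff.1 h1).1
    · rintro rfl
      exact ⟨hy, Finset.mem_sdiff.2 ⟨(mem_of_inter_eq_singleton hp.2.2.2.2.1).1, hp.y_not⟩⟩

theorem BF.no_double_loose {k : ℕ} {E : Finset (Finset V)} (H : BF k E) {C : List (Finset V)}
    (hC : LooseCycle C) (hCE : ∀ e ∈ C, e ∈ E) {P : List (Finset V)} (hP : ∀ p ∈ P, p ∈ E) {x y : V}
    (hp : PathOn (vset C) P x y) : False := by
  have hx := mem_of_inter_eq_singleton hp.2.2.2.1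
  have hy := mem_of_inter_eq_singleton hp.2.2.2.2.1
  obtain ⟨e, he, hxe⟩ := mem_vset.1 hx.2
  obtain ⟨l', hperm, hl⟩ := hC.rot_last he
  rw [← vset_perm hperm] at hp hx hy
  have hlast : (l' ++ [e]).getD ((l' ++ [e]).length - 1) ∅ = e := by
    rw [List.getD_append_right _ _ _ _ (by simp)]; simp
  obtain ⟨a, ha, hya⟩ := mem_vset_getD.1 hy.2
  have hE' : ∀ f ∈ l' ++ [e], f ∈ E := fun f hf => hCE f (hperm.mem_iff.1 hf)
  apply H.hb
  refine ⟨(l' ++ [e]) ++ P, ?_, Or.inr (Or.inr (Or.inl ⟨?_, ?_, l' ++ [e], P, rfl, hl, hp.1, hp.2.1,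
    x, y, hp.2.2.1, hp.inter, ?_, a, ha, ?_⟩))⟩
  · intro b hb
    rw [List.mem_toFinset, List.mem_append] at hb
    rcases hb with hb | hb
    · exact hE' _ hb
    · exact hP _ hb
  · apply PathOn.valid H.hk (hl.valid H.hk) hp
    intro b hb; exact H.hu _ (hE' _ hb)
  · apply chain_append hl.chain hp.1.chain
    intro _ _
    rw [hlast]
    exact ⟨x, Finset.mem_inter.2 ⟨hxe, hx.1⟩⟩
  · rw [hlast]
    ext z
    rw [Finset.mem_inter, Finset.mem_singleton]
    constructor
    · rintro ⟨h1, h2⟩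
      apply eq_of_inter_eq_singleton hp.2.2.2.1 (Finset.mem_sdiff.1 h1).1
      exact subset_vset (by simp) h2
    · rintro rfl
      exact ⟨Finset.mem_sdiff.2 ⟨hx.1, hp.x_not⟩, hxe⟩
  · ext z
    rw [Finset.mem_inter, Finset.mem_singleton]
    constructor
    · rintro ⟨h1, h2⟩
      apply eq_of_inter_eq_singleton hp.2.2.2.2.1 (Finset.mem_sdiff.1 h1).1
      exact subset_vset (getD_mem_of_lt ha) h2
    · rintro rfl
      exact ⟨Finset.mem_sdiff.2 ⟨hy.1, hp.y_not⟩, hya⟩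

theorem BF.no_double_op {k : ℕ} {E : Finset (Finset V)} (H : BF k E) {e₁ e₂ e₃ e₄ : Finset V}
    (h : IsOP E e₁ e₂) (h' : IsOP E e₃ e₄) {x y : V} (hxy : x ≠ y)
    (hi : (e₁ ∪ e₂) ∩ (e₃ ∪ e₄) = {x, y}) (hx : x ∈ e₁ \ e₂) (hx' : x ∈ e₄ \ e₃)
    (hy : y ∈ e₂ \ e₁) (hy' : y ∈ e₃ \ e₄) (hc : (e₃ ∩ e₄).card ≤ k - 2) : False := by
  have hk := H.hk
  have key : ∀ z, (z ∈ e₁ ∨ z ∈ e₂) → (z ∈ e₃ ∨ z ∈ e₄) → z = x ∨ z = y := by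
    intro z h1 h2
    have : z ∈ (e₁ ∪ e₂) ∩ (e₃ ∪ e₄) := by
      rw [Finset.mem_inter, Finset.mem_union, Finset.mem_union]; exact ⟨h1, h2⟩
    rw [hi] at this; simpa using this
  rw [Finset.mem_sdiff] at hx hx' hy hy'
  have h3 : e₃ ∩ (e₁ ∪ e₂) = {y} := by
    ext z
    rw [Finset.mem_inter, Finset.mem_union, Finset.mem_singleton]
    constructor
    · rintro ⟨a, b⟩
      rcases key z b (Or.inl a) with rfl | rfl
      · exact (hx'.2 a).elim
      · rfl
    · rintro rfl; exact ⟨hy'.1, Or.inr hy.1⟩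
  have h4 : e₄ ∩ ((e₁ ∪ e₂) ∪ e₃) ⊆ insert x (e₃ ∩ e₄) := by
    intro z hz
    rw [Finset.mem_inter, Finset.mem_union, Finset.mem_union] at hz
    rw [Finset.mem_insert, Finset.mem_inter]
    obtain ⟨a, b | b⟩ := hz
    · rcases key z b (Or.inr a) with rfl | rfl
      · exact Or.inl rfl
      · exact (hy'.2 a).elim
    · exact Or.inr ⟨b, a⟩
  have h5 : x ∈ e₄ ∩ ((e₁ ∪ e₂) ∪ e₃) := by simp [hx.1, hx'.1]
  have h6 := Finset.card_le_card h4
  have h7 := Finset.card_insert_le x (e₃ ∩ e₄)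
  have h8 := Finset.card_pos.2 ⟨x, h5⟩
  apply H.hb
  refine ⟨([e₁, e₂] ++ [e₃]) ++ [e₄], ?_, Or.inr (Or.inl ⟨?_, ?_, e₁, e₂, e₃, e₄, rfl,
    H.overlapPair h, H.overlapPair h', hc, x, y, hxy, ?_, ?_, ?_⟩)⟩
  · intro a ha
    simp at ha
    rcases ha with rfl | rfl | rfl | rfl
    exacts [h.1, h.2.1, h'.1, h'.2.1]
  · apply valid_snoc
    · apply valid_snoc (H.overlapPair h).valid
      · simp only [List.mem_cons, List.not_mem_nil, or_false, not_or]
        exact ⟨fun a => hx'.2 (a ▸ hx.1), fun a => hy.2 (by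
          have := H.hu _ h.2.1
          have h9 : e₂ ⊆ e₃ ∩ (e₁ ∪ e₂) := by
            rw [← a]; exact Finset.subset_inter subset_rfl (a ▸ Finset.subset_union_right)
          rw [h3] at h9
          have := Finset.card_le_card h9
          simp at this; omega)⟩
      · rw [vset_pair, h3]; simp
      · rw [vset_pair, h3]; simp; omega
    · simp only [List.cons_append, List.nil_append, List.mem_cons, List.not_mem_nil, or_false, not_or]
      refine ⟨?_, fun a => hy'.2 (a ▸ hy.1), fun a => hx'.2 (a ▸ hx'.1)⟩
      rintro rfl
      have := H.hu _ h.1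
      have h9 : e₄ ⊆ ({x, y} : Finset V) := by
        intro z hz
        rcases key z (Or.inl hz) (Or.inr hz) with rfl | rfl <;> simp
      have := Finset.card_le_card h9
      have := Finset.card_le_two (a := x) (b := y)
      omega
    · rw [vset_append, vset_pair, vset_cons, vset_nil, Finset.union_empty]; omega
    · rw [vset_append, vset_pair, vset_cons, vset_nil, Finset.union_empty]; omega
  · apply chain_snoc
    · apply chain_snoc (H.overlapPair h).chain
      intro _
      exact ⟨y, by simp [hy.1, hy'.1]⟩
    · intro _
      have := h'.2.2.2
      show (e₃ ∩ e₄).Nonempty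
      rw [← Finset.card_pos]; omega
  · rw [vset_pair, vset_pair, hi]
  · ext z
    simp only [Finset.mem_inter, Finset.mem_sdiff, Finset.mem_singleton]
    constructor
    · rintro ⟨a, b⟩
      rcases key z (Or.inl a.1) (Or.inr b.1) with rfl | rfl
      · rfl
      · exact (hy.2 a.1).elim
    · rintro rfl; exact ⟨hx, hx'⟩
  · ext z
    simp only [Finset.mem_inter, Finset.mem_sdiff, Finset.mem_singleton]
    constructor
    · rintro ⟨a, b⟩
      rcases key z (Or.inr a.1) (Or.inl b.1) with rfl | rfl
      · exact (hx'.2 b.1).elim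
      · rfl
    · rintro rfl; exact ⟨hy, hy'⟩

theorem getD_snoc_last (l : List (Finset V)) (e : Finset V) :
    (l ++ [e]).getD ((l ++ [e]).length - 1) ∅ = e := by
  rw [List.getD_append_right _ _ _ _ (by simp)]; simp

theorem BF.no_c2c_nil {k : ℕ} {E : Finset (Finset V)} (H : BF k E) {P₁ P₃ : List (Finset V)}
    (h₁ : OPorLC k P₁) (hE₁ : ∀ e ∈ P₁, e ∈ E) (h₃ : OPorLC k P₃) (hE₃ : ∀ e ∈ P₃, e ∈ E)
    (hc : (vset P₁ ∩ vset P₃).card = 1) : False := by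
  have hk := H.hk
  obtain ⟨s, hs⟩ := Finset.card_eq_one.1 hc
  obtain ⟨hs1, hs3⟩ := mem_of_inter_eq_singleton hs
  obtain ⟨e, he, hse⟩ := mem_vset.1 hs1
  obtain ⟨f, hf, hsf⟩ := mem_vset.1 hs3
  obtain ⟨l₁, hp1, ho1⟩ := h₁.rot_last he
  obtain ⟨l₃, hp3, ho3⟩ := h₃.rot_head hf
  rw [← vset_perm hp1, ← vset_perm hp3] at hs hc
  have hE1' : ∀ e' ∈ l₁ ++ [e], e' ∈ E := fun a ha => hE₁ a (hp1.mem_iff.1 ha)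
  have hE3' : ∀ e' ∈ f :: l₃, e' ∈ E := fun a ha => hE₃ a (hp3.mem_iff.1 ha)
  have hf1 : f ∩ vset (l₁ ++ [e]) = {s} := by
    apply Finset.Subset.antisymm
    · rw [← hs, Finset.inter_comm]
      exact Finset.inter_subset_inter_left (subset_vset (by simp))
    · rw [Finset.singleton_subset_iff, Finset.mem_inter]
      exact ⟨hsf, subset_vset (l := l₁ ++ [e]) (e := e) (by simp) hse⟩
  apply H.hb
  refine ⟨(l₁ ++ [e]) ++ [] ++ (f :: l₃), ?_, Or.inr (Or.inr (Or.inr (Or.inr ⟨?_, ?_, l₁ ++ [e], [],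
    f :: l₃, rfl, ho1, ho3, Or.inl ⟨rfl, hc⟩⟩)))⟩
  · intro a ha
    rw [List.append_nil, List.mem_toFinset, List.mem_append] at ha
    rcases ha with ha | ha
    · exact hE1' a ha
    · exact hE3' a ha
  · rw [List.append_nil]
    apply valid_append (ho1.valid hk) (ho3.valid hk)
    · apply disj_of_card (k := k) (fun a ha => H.hu _ (hE1' a ha))
      omega
    · rw [hs]; simpa using hsf
    · simp only [List.getD_cons_zero]; rw [hf1]; simp
    · simp only [List.getD_cons_zero]; rw [hf1]; simp; omega
  · rw [List.append_nil]
    apply chain_append ho1.chain ho3.chain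
    intro _ _
    rw [getD_snoc_last, List.getD_cons_zero]
    exact ⟨s, Finset.mem_inter.2 ⟨hse, hsf⟩⟩

theorem BF.no_c2c_path {k : ℕ} {E : Finset (Finset V)} (H : BF k E) {P₁ P P₃ : List (Finset V)}
    (h₁ : OPorLC k P₁) (hE₁ : ∀ e ∈ P₁, e ∈ E) (h₃ : OPorLC k P₃) (hE₃ : ∀ e ∈ P₃, e ∈ E)
    (hP : LoosePath P) (hPE : ∀ e ∈ P, e ∈ E)
    (h13 : vset P₁ ∩ vset P₃ = ∅)
    (hP0 : (P.getD 0 ∅ ∩ vset P₁).card = 1)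
    (hPl : (P.getD (P.length - 1) ∅ ∩ vset P₃).card = 1)
    (hPi : ∀ i, 0 < i → i < P.length → P.getD i ∅ ∩ vset P₁ = ∅)
    (hPj : ∀ i, i + 1 < P.length → P.getD i ∅ ∩ vset P₃ = ∅) : False := by
  have hk := H.hk
  have hlen : 0 < P.length := List.length_pos_iff.2 hP.1
  obtain ⟨x, hx⟩ := Finset.card_eq_one.1 hP0
  obtain ⟨y, hy⟩ := Finset.card_eq_one.1 hPl
  obtain ⟨hx1, hx2⟩ := mem_of_inter_eq_singleton hx
  obtain ⟨hy1, hy2⟩ := mem_of_inter_eq_singleton hy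
  obtain ⟨e, he, hxe⟩ := mem_vset.1 hx2
  obtain ⟨f, hf, hyf⟩ := mem_vset.1 hy2
  obtain ⟨l₁, hp1, ho1⟩ := h₁.rot_last he
  obtain ⟨l₃, hp3, ho3⟩ := h₃.rot_head hf
  rw [← vset_perm hp1] at hx hx2 h13 hPi
  rw [← vset_perm hp3] at hy hy2 h13 hPj
  have hE1' : ∀ e' ∈ l₁ ++ [e], e' ∈ E := fun a ha => hE₁ a (hp1.mem_iff.1 ha)
  have hE3' : ∀ e' ∈ f :: l₃, e' ∈ E := fun a ha => hE₃ a (hp3.mem_iff.1 ha)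
  have i1 : vset (l₁ ++ [e]) ∩ vset P = {x} := by
    ext z
    rw [Finset.mem_inter, mem_vset_getD (l := P), Finset.mem_singleton]
    constructor
    · rintro ⟨h1, i, hi, hz⟩
      by_cases h0 : i = 0
      · subst h0; exact eq_of_inter_eq_singleton hx hz h1
      · exact (not_of_inter_eq_empty (hPi i (by omega) hi) hz h1).elim
    · rintro rfl; exact ⟨hx2, 0, hlen, hx1⟩
  have i3 : vset P ∩ vset (f :: l₃) = {y} := by
    ext z
    rw [Finset.mem_inter, mem_vset_getD (l := P), Finset.mem_singleton]
    constructor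
    · rintro ⟨⟨i, hi, hz⟩, h1⟩
      by_cases h0 : i = P.length - 1
      · subst h0; exact eq_of_inter_eq_singleton hy hz h1
      · exact (not_of_inter_eq_empty (hPj i (by omega)) hz h1).elim
    · rintro rfl; exact ⟨⟨P.length - 1, by omega, hy1⟩, hy2⟩
  have i13 : vset ((l₁ ++ [e]) ++ P) ∩ vset (f :: l₃) = {y} := by
    rw [vset_append, Finset.union_inter_distrib_right, h13, i3]; simp
  apply H.hb
  refine ⟨(l₁ ++ [e]) ++ P ++ (f :: l₃), ?_, Or.inr (Or.inr (Or.inr (Or.inr ⟨?_, ?_, l₁ ++ [e], P,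
    f :: l₃, rfl, ho1, ho3, Or.inr ⟨hP.1, hP, ?_, h13, ?_, ?_⟩⟩)))⟩
  · intro a ha
    rw [List.mem_toFinset, List.mem_append, List.mem_append (s := l₁ ++ [e])] at ha
    rcases ha with (ha | ha) | ha
    · exact hE1' a ha
    · exact hPE a ha
    · exact hE3' a ha
  · apply valid_append _ (ho3.valid hk)
    · apply disj_of_card (k := k)
      · intro a ha
        rw [List.mem_append (s := l₁ ++ [e])] at ha
        rcases ha with ha | ha
        · exact H.hu _ (hE1' a ha)
        · exact H.hu _ (hPE a ha)
      · rw [i13]; simp; omega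
    · rw [i13]; simpa using hyf
    · refine Finset.card_pos.2 ⟨y, ?_⟩
      rw [Finset.mem_inter, List.getD_cons_zero, vset_append]
      exact ⟨hyf, Finset.mem_union_right _ (mem_vset_getD.2 ⟨_, by omega, hy1⟩)⟩
    · have h1 : (f :: l₃).getD 0 ∅ ∩ vset (l₁ ++ [e] ++ P) ⊆ {y} := by
        rw [← i13, Finset.inter_comm]
        exact Finset.inter_subset_inter_left (subset_vset (by simp))
      have := Finset.card_le_card h1
      simp only [Finset.card_singleton] at this
      omega
    · apply valid_append (ho1.valid hk) (hP.valid hk)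
      · apply disj_of_card (k := k) (fun a ha => H.hu _ (hE1' a ha))
        rw [i1]; simp; omega
      · rw [i1]; simpa using hx1
      · rw [hx]; simp
      · rw [hx]; simp; omega
  · apply chain_append _ ho3.chain
    · intro _ _
      refine ⟨y, Finset.mem_inter.2 ⟨?_, by simpa using hyf⟩⟩
      rw [List.length_append, List.getD_append_right _ _ _ _ (by omega)]
      have : (l₁ ++ [e]).length + P.length - 1 - (l₁ ++ [e]).length = P.length - 1 := by omega
      rw [this]; exact hy1
    · apply chain_append ho1.chain hP.chain
      intro _ _
      rw [getD_snoc_last]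
      exact ⟨x, Finset.mem_inter.2 ⟨hxe, hx1⟩⟩
  · rw [i1]; simp
  · rw [i3]; simp
  · intro h2
    exact ⟨hPi 1 (by omega) (by omega), hPj _ (by omega)⟩

/-! ### Reachability and shortest chains -/

/-- Two vertices joined by a chain of edges of `F`. -/
def Rch (F : Finset (Finset V)) : V → V → Prop :=
  Relation.ReflTransGen fun u v => ∃ e ∈ F, u ∈ e ∧ v ∈ e

theorem Rch.symm {F : Finset (Finset V)} {u v : V} (h : Rch F u v) : Rch F v u := by
  induction h with
  | refl => exact Relation.ReflTransGen.refl
  | tail _ h ih =>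
    obtain ⟨e, he, h1, h2⟩ := h
    exact Relation.ReflTransGen.head ⟨e, he, h2, h1⟩ ih

theorem Rch.trans {F : Finset (Finset V)} {u v w : V} (h : Rch F u v) (h' : Rch F v w) :
    Rch F u w := Relation.ReflTransGen.trans h h'

theorem Rch.of_edge {F : Finset (Finset V)} {u v : V} {e : Finset V} (he : e ∈ F) (hu : u ∈ e)
    (hv : v ∈ e) : Rch F u v := Relation.ReflTransGen.single ⟨e, he, hu, hv⟩

theorem Rch.mono {F F' : Finset (Finset V)} {u v : V} (h : Rch F u v) (hs : F ⊆ F') :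
    Rch F' u v :=
  Relation.ReflTransGen.mono (fun _ _ (h : ∃ e ∈ F, _ ∈ e ∧ _ ∈ e) =>
    let ⟨e, he, h'⟩ := h; ⟨e, hs he, h'⟩) u v h

/-- A chain of `m` edges of `F` from `x` to `y`. -/
def Ch (F : Finset (Finset V)) (x y : V) (m : ℕ) (p : ℕ → Finset V) : Prop :=
  1 ≤ m ∧ x ∈ p 0 ∧ y ∈ p (m - 1) ∧ (∀ i < m, p i ∈ F) ∧
    ∀ i, i + 1 < m → (p i ∩ p (i + 1)).Nonempty

theorem Rch.exists_ch {F : Finset (Finset V)} {x y : V} (h : Rch F x y) :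
    x = y ∨ ∃ m p, Ch F x y m p := by
  induction h using Relation.ReflTransGen.head_induction_on with
  | refl => exact Or.inl rfl
  | head h _ ih =>
    right
    obtain ⟨e, he, hu, hv⟩ := h
    rcases ih with rfl | ⟨m, p, h1, h2, h3, h4, h5⟩
    · exact ⟨1, fun _ => e, le_rfl, hu, hv, fun _ _ => he, fun i hi => by omega⟩
    · refine ⟨m + 1, fun i => if i = 0 then e else p (i - 1), by omega, by simpa using hu, ?_, ?_, ?_⟩
      · have : m ≠ 0 := by omega
        simpa [this] using h3
      · intro i hi
        by_cases h0 : i = 0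
        · simpa [h0] using he
        · simpa [h0] using h4 (i-1) (by omega)
      · intro i hi
        by_cases h0 : i = 0
        · subst h0
          exact ⟨_, Finset.mem_inter.2 ⟨hv, h2⟩⟩
        · have := h5 (i-1) (by omega)
          rw [Nat.sub_add_cancel (by omega)] at this
          simpa [h0] using this

theorem Ch.sub {F : Finset (Finset V)} {x y : V} {m : ℕ} {p : ℕ → Finset V} (h : Ch F x y m p)
    {i j : ℕ} (hij : i ≤ j) (hj : j < m) {u v : V} (hu : u ∈ p i) (hv : v ∈ p j) :
    Ch F u v (j - i + 1) (fun t => p (t + i)) := by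
  obtain ⟨h1, h2, h3, h4, h5⟩ := h
  refine ⟨by omega, by simpa using hu, ?_, fun t ht => h4 _ (by omega), fun t ht => ?_⟩
  · have : j - i + 1 - 1 + i = j := by omega
    rw [← this] at hv; exact hv
  · have := h5 (t + i) (by omega)
    rw [show t + i + 1 = t + 1 + i by omega] at this
    exact this

/-- Properties of a shortest chain among those whose end vertices satisfy `Q`. -/
theorem Ch.shortest {F : Finset (Finset V)} {Q : V → V → Prop} {x y : V} {m : ℕ} {p : ℕ → Finset V}
    (h : Ch F x y m p) (hQ : Q x y)
    (hmin : ∀ m' < m, ∀ x' y' p', Q x' y' → ¬ Ch F x' y' m' p') :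
    (∀ i j, i + 1 < j → j < m → p i ∩ p j = ∅) ∧
    (∀ i z, z ∈ p i → i + 1 < m → ¬ Q x z) ∧
    (∀ i z, z ∈ p i → 0 < i → i < m → ¬ Q z y) ∧
    (∀ i, i + 1 < m → p i ≠ p (i + 1)) := by
  have hh := h
  obtain ⟨h1, h2, h3, h4, h5⟩ := h
  have a1 : ∀ i j, i + 1 < j → j < m → p i ∩ p j = ∅ := by
    intro i j hij hj
    by_contra hne
    have hne := Finset.nonempty_iff_ne_empty.2 hne
    apply hmin (m - (j - i - 1)) (by omega) x y (fun t => if t ≤ i then p t else p (t + (j - i - 1))) hQ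
    refine ⟨by omega, by simpa using h2, ?_, ?_, ?_⟩
    · have e1 : ¬ (m - (j - i - 1) - 1 ≤ i) := by omega
      have e2 : m - (j - i - 1) - 1 + (j - i - 1) = m - 1 := by omega
      simp only [e1, if_false, e2]; exact h3
    · intro t ht
      dsimp only
      split_ifs
      · exact h4 _ (by omega)
      · exact h4 _ (by omega)
    · intro t ht
      by_cases c1 : t + 1 ≤ i
      · have c2 : t ≤ i := by omega
        simp only [c1, c2, if_true]; exact h5 t (by omega)
      · by_cases c2 : t ≤ i
        · have : t = i := by omega
          subst this
          have e2 : t + 1 + (j - t - 1) = j := by omega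
          simp only [c1, c2, if_true, if_false, e2]; exact hne
        · simp only [c1, c2, if_false]
          have := h5 (t + (j - i - 1)) (by omega)
          rw [show t + (j - i - 1) + 1 = t + 1 + (j - i - 1) by omega] at this
          exact this
  have a2 : ∀ i z, z ∈ p i → i + 1 < m → ¬ Q x z := by
    intro i z hz hi hq
    exact hmin (i - 0 + 1) (by omega) x z _ hq (hh.sub (Nat.zero_le i) (by omega) h2 hz)
  have a3 : ∀ i z, z ∈ p i → 0 < i → i < m → ¬ Q z y := by
    intro i z hz h0 hi hq
    exact hmin (m - 1 - i + 1) (by omega) z y _ hq (hh.sub (by omega) (by omega) hz h3)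
  refine ⟨a1, a2, a3, ?_⟩
  intro i hi heq
  by_cases c1 : i + 2 < m
  · have := h5 (i+1) (by omega)
    rw [← heq, a1 i (i+2) (by omega) c1] at this
    exact Finset.not_nonempty_empty this
  · have hi' : i + 1 = m - 1 := by omega
    rw [← hi', ← heq] at h3
    exact a2 i y h3 hi hQ

theorem exists_shortest {F : Finset (Finset V)} {Q : V → V → Prop}
    (h : ∃ m x y p, Q x y ∧ Ch F x y m p) :
    ∃ m x y p, Q x y ∧ Ch F x y m p ∧ ∀ m' < m, ∀ x' y' p', Q x' y' → ¬ Ch F x' y' m' p' := by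
  classical
  obtain ⟨x, y, p, h1, h2⟩ := Nat.find_spec h
  refine ⟨Nat.find h, x, y, p, h1, h2, ?_⟩
  intro m' hm' x' y' p' hq hc
  exact Nat.find_min h hm' ⟨x', y', p', hq, hc⟩

/-- The list of the first `m` values. -/
def mkL (p : ℕ → Finset V) (m : ℕ) : List (Finset V) := (List.range m).map p

theorem mkL_length (p : ℕ → Finset V) (m : ℕ) : (mkL p m).length = m := by simp [mkL]

theorem mkL_getD {p : ℕ → Finset V} {m i : ℕ} (h : i < m) : (mkL p m).getD i ∅ = p i := by
  rw [List.getD_eq_getElem _ _ (by rw [mkL_length]; exact h)]; simp [mkL]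

theorem mem_mkL {p : ℕ → Finset V} {m : ℕ} {e : Finset V} : e ∈ mkL p m ↔ ∃ i < m, p i = e := by
  simp [mkL]

theorem mkL_loosePath {p : ℕ → Finset V} {m : ℕ} (hm : 1 ≤ m)
    (hne : ∀ i < m, (p i).Nonempty)
    (h1 : ∀ i j, i + 1 < j → j < m → p i ∩ p j = ∅)
    (h2 : ∀ i, i + 1 < m → (p i ∩ p (i + 1)).card = 1)
    (h3 : ∀ i, i + 1 < m → p i ≠ p (i + 1)) : LoosePath (mkL p m) := by
  refine ⟨?_, ?_, ?_⟩
  · intro h; have := mkL_length p m; rw [h] at this; simp at this; omega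
  · rw [mkL]
    apply List.Nodup.map_on _ List.nodup_range
    have key : ∀ i j, i < j → j < m → p i ≠ p j := by
      intro i j hij hj heq
      by_cases c : j = i + 1
      · subst c; exact h3 i hj heq
      · have := h1 i j (by omega) hj
        rw [heq, Finset.inter_self] at this
        have h := hne j hj
        rw [this] at h; exact Finset.not_nonempty_empty h
    intro i hi j hj heq
    rw [List.mem_range] at hi hj
    by_contra hne
    rcases Nat.lt_or_gt_of_ne hne with c | c
    · exact key i j c hj heq
    · exact key j i c hi heq.symm
  · intro i j hij hj
    rw [mkL_length] at hj
    rw [mkL_getD hj, mkL_getD (hij.trans hj)]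
    split_ifs with c
    · subst c; exact h2 i hj
    · rw [h1 i j (by omega) hj]; rfl

/-- Some two distinct vertices of `g` are joined by a chain of edges of `F`. -/
def Closed' (F : Finset (Finset V)) (g : Finset V) : Prop :=
  ∃ x ∈ g, ∃ y ∈ g, x ≠ y ∧ Rch F x y

theorem eq_of_card_inter_le_one {A B : Finset V} (h : (A ∩ B).card ≤ 1) {x y : V} (hx : x ∈ A)
    (hx' : x ∈ B) (hy : y ∈ A) (hy' : y ∈ B) : x = y :=
  Finset.card_le_one.1 h x (Finset.mem_inter.2 ⟨hx, hx'⟩) y (Finset.mem_inter.2 ⟨hy, hy'⟩)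

theorem pathOn_of_min {F : Finset (Finset V)} {g : Finset V} (hg : ∀ f ∈ F, (g ∩ f).card ≤ 1)
    (hF : ∀ e ∈ F, ∀ f ∈ F, e ≠ f → (e ∩ f).card ≤ 1) {x y : V} {m : ℕ} {p : ℕ → Finset V}
    (hx : x ∈ g) (hy : y ∈ g) (hxy : x ≠ y) (h : Ch F x y m p)
    (hmin : ∀ m' < m, ∀ x' y' p', (x' ∈ g ∧ y' ∈ g ∧ x' ≠ y') → ¬ Ch F x' y' m' p') :
    PathOn g (mkL p m) x y := by
  obtain ⟨a1, a2, a3, a4⟩ := h.shortest (Q := fun x y => x ∈ g ∧ y ∈ g ∧ x ≠ y) ⟨hx, hy, hxy⟩ hmin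
  obtain ⟨h1, h2, h3, h4, h5⟩ := h
  have hm : 2 ≤ m := by
    by_contra hm
    have : m = 1 := by omega
    subst this
    exact hxy (eq_of_card_inter_le_one (hg _ (h4 0 (by omega))) hx h2 hy h3)
  have sing : ∀ i < m, ∀ z, z ∈ p i → z ∈ g → p i ∩ g = {z} := by
    intro i hi z hz hzg
    ext w
    rw [Finset.mem_inter, Finset.mem_singleton]
    constructor
    · rintro ⟨b1, b2⟩
      exact eq_of_card_inter_le_one (hg _ (h4 i hi)) b2 b1 hzg hz
    · rintro rfl; exact ⟨hz, hzg⟩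
  refine ⟨?_, by rw [mkL_length]; exact hm, hxy, ?_, ?_, ?_⟩
  · apply mkL_loosePath h1
    · intro i hi
      by_cases c : i + 1 < m
      · exact (h5 i c).mono Finset.inter_subset_left
      · exact ⟨y, by rw [show i = m - 1 by omega]; exact h3⟩
    · exact a1
    · intro i hi
      have b1 := hF _ (h4 i (by omega)) _ (h4 (i+1) hi) (a4 i hi)
      have b2 := Finset.card_pos.2 (h5 i hi)
      omega
    · exact a4
  · rw [mkL_getD (by omega)]; exact sing 0 (by omega) x h2 hx
  · rw [mkL_length, mkL_getD (by omega)]; exact sing _ (by omega) y h3 hy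
  · intro i hi hi'
    rw [mkL_length] at hi'
    rw [mkL_getD (by omega)]
    rw [Finset.eq_empty_iff_forall_notMem]
    intro z hz
    rw [Finset.mem_inter] at hz
    by_cases c : z = x
    · exact a3 i z hz.1 hi (by omega) ⟨hz.2, hy, c ▸ hxy⟩
    · exact a2 i z hz.1 hi' ⟨hx, hz.2, fun h => c h.symm⟩

theorem Closed'.exists_ch {F : Finset (Finset V)} {g : Finset V} (h : Closed' F g) :
    ∃ m x y p, (x ∈ g ∧ y ∈ g ∧ x ≠ y) ∧ Ch F x y m p := by
  obtain ⟨x, hx, y, hy, hxy, hr⟩ := h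
  rcases hr.exists_ch with h | ⟨m, p, h⟩
  · exact (hxy h).elim
  · exact ⟨m, x, y, p, ⟨hx, hy, hxy⟩, h⟩

theorem Closed'.exists_path {F : Finset (Finset V)} {g : Finset V} (h : Closed' F g)
    (hg : ∀ f ∈ F, (g ∩ f).card ≤ 1)
    (hF : ∀ e ∈ F, ∀ f ∈ F, e ≠ f → (e ∩ f).card ≤ 1) :
    ∃ P x y, (∀ e ∈ P, e ∈ F) ∧ PathOn g P x y := by
  obtain ⟨m, x, y, p, ⟨hx, hy, hxy⟩, hc, hmin⟩ := exists_shortest h.exists_ch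
  refine ⟨mkL p m, x, y, ?_, pathOn_of_min hg hF hx hy hxy hc hmin⟩
  intro e he
  obtain ⟨i, hi, rfl⟩ := mem_mkL.1 he
  exact hc.2.2.2.1 i hi

theorem PathOn.looseCycle {g : Finset V} {P : List (Finset V)} {x y : V} (h : PathOn g P x y) :
    LooseCycle (g :: P) := by
  have hx := (mem_of_inter_eq_singleton h.2.2.2.1).2
  have hy := (mem_of_inter_eq_singleton h.2.2.2.2.1).2
  have h2 := h.2.1
  refine ⟨by rw [List.length_cons]; omega, List.nodup_cons.2 ⟨?_, h.1.2.1⟩, ?_⟩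
  · intro hgP
    obtain ⟨i, hi, hig⟩ := exists_getD_of_mem hgP
    have b1 := h.reverse_aux (i := i) (by rw [hig]; exact hx) hx hi
    have b2 := h.reverse_aux (i := i) (by rw [hig]; exact hy) hy hi
    have hxy := h.2.2.1
    rcases b1 with b1 | b1
    · rcases b2 with b2 | b2
      · exact hxy b2.2.symm
      · omega
    · exact hxy b1.2
  · intro i j hij hj
    rw [List.length_cons] at hj ⊢
    obtain ⟨j, rfl⟩ : ∃ j', j = j' + 1 := ⟨j - 1, by omega⟩
    rw [List.getD_cons_succ]
    by_cases c : i = 0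
    · subst c
      rw [List.getD_cons_zero, Finset.inter_comm]
      by_cases d : j = 0
      · subst d; rw [h.2.2.2.1, if_pos (by omega)]; simp
      · by_cases d' : j = P.length - 1
        · subst d'; rw [h.2.2.2.2.1, if_pos (by omega)]; simp
        · rw [h.2.2.2.2.2 j (by omega) (by omega), if_neg (by omega)]; simp
    · obtain ⟨i, rfl⟩ : ∃ i', i = i' + 1 := ⟨i - 1, by omega⟩
      rw [List.getD_cons_succ, h.1.2.2 i j (by omega) (by omega)]
      congr 1
      rw [eq_iff_iff]
      omega

theorem goodAt_snoc_old {l : List (Finset V)} {g : Finset V} {i : ℕ} (h : i < l.length) :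
    GoodAt (l ++ [g]) i ↔ GoodAt l i := by
  rw [GoodAt, GoodAt, oldOf_append_left h]

theorem goodAt_snoc_new {l : List (Finset V)} {g : Finset V} :
    GoodAt (l ++ [g]) l.length ↔ (g ∩ vset l).card = 1 := by
  have := oldOf_append_right (l₁ := l) (l₂ := [g]) (i := 0)
  simp only [Nat.add_zero] at this
  rw [GoodAt, this]
  simp [vset_nil]

theorem BF.extend {k : ℕ} {E : Finset (Finset V)} (H : BF k E) {l0 : List (Finset V)}
    (hnd : l0.Nodup) (hne : l0 ≠ []) (hE : ∀ e ∈ l0, e ∈ E)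
    (h1 : ¬ Closed' (E \ l0.toFinset) (vset l0))
    (h2 : ∀ g ∈ E \ l0.toFinset, ¬ Closed' ((E \ l0.toFinset).erase g) g) :
    ∃ T, (l0 ++ T).Nodup ∧ (l0 ++ T).toFinset = E ∧
      ∀ i, l0.length ≤ i → i < (l0 ++ T).length → GoodAt (l0 ++ T) i := by
  have main : ∀ n, ∀ T : List (Finset V), (l0 ++ T).Nodup → (∀ e ∈ T, e ∈ E) →
      (∀ i, l0.length ≤ i → i < (l0 ++ T).length → GoodAt (l0 ++ T) i) →
      (∀ v ∈ vset T, ∃ s ∈ vset l0, Rch T.toFinset v s) →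
      E.card - (l0 ++ T).length = n →
      ∃ T, (l0 ++ T).Nodup ∧ (l0 ++ T).toFinset = E ∧
      ∀ i, l0.length ≤ i → i < (l0 ++ T).length → GoodAt (l0 ++ T) i := by
    intro n
    induction n with
    | zero =>
      intro T hT1 hT2 hT3 hT4 hn
      refine ⟨T, hT1, ?_, hT3⟩
      apply Finset.eq_of_subset_of_card_le
      · intro e he
        rw [List.mem_toFinset, List.mem_append] at he
        exact he.elim (hE e) (hT2 e)
      · rw [List.toFinset_card_of_nodup hT1]; omega
    | succ n ih =>
      intro T hT1 hT2 hT3 hT4 hn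
      have hsub : (l0 ++ T).toFinset ⊆ E := by
        intro e he
        rw [List.mem_toFinset, List.mem_append] at he
        exact he.elim (hE e) (hT2 e)
      have hcard := List.toFinset_card_of_nodup hT1
      have hl0 : ∃ a, a ∈ l0 := List.exists_mem_of_ne_nil _ hne
      obtain ⟨a, ha⟩ := hl0
      obtain ⟨e, he, g, hg, z, hz⟩ := H.hc (l0 ++ T).toFinset hsub ⟨a, by simp [ha]⟩ (by
        rw [← Finset.card_pos, Finset.card_sdiff_of_subset hsub]; omega)
      rw [Finset.mem_inter] at hz
      rw [Finset.mem_sdiff, List.mem_toFinset] at hg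
      rw [List.mem_toFinset] at he
      have hzV : z ∈ vset (l0 ++ T) := mem_vset.2 ⟨e, he, hz.1⟩
      have hgl0 : g ∉ l0 := fun h => hg.2 (List.mem_append_left _ h)
      have hgT : g ∉ T := fun h => hg.2 (List.mem_append_right _ h)
      have hgF : g ∈ E \ l0.toFinset := by simp [hg.1, hgl0]
      have hTF : T.toFinset ⊆ (E \ l0.toFinset).erase g := by
        intro f hf
        rw [List.mem_toFinset] at hf
        rw [Finset.mem_erase, Finset.mem_sdiff, List.mem_toFinset]
        refine ⟨fun h => hgT (h ▸ hf), hT2 f hf, fun h => ?_⟩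
        exact (List.nodup_append'.1 hT1).2.2 h hf
      have hTF' : T.toFinset ⊆ E \ l0.toFinset := hTF.trans (Finset.erase_subset _ _)
      have hreach : ∀ v ∈ vset (l0 ++ T), ∃ s ∈ vset l0, Rch T.toFinset v s := by
        intro v hv
        rw [vset_append, Finset.mem_union] at hv
        rcases hv with hv | hv
        · exact ⟨v, hv, Relation.ReflTransGen.refl⟩
        · exact hT4 v hv
      have huniq : ∀ x ∈ g ∩ vset (l0 ++ T), ∀ y ∈ g ∩ vset (l0 ++ T), x = y := by
        intro x hx y hy
        by_contra hxy
        rw [Finset.mem_inter] at hx hy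
        obtain ⟨s, hs, hxs⟩ := hreach x hx.2
        obtain ⟨s', hs', hys⟩ := hreach y hy.2
        by_cases c : s = s'
        · subst c
          exact h2 g hgF ⟨x, hx.1, y, hy.1, hxy, (hxs.trans hys.symm).mono hTF⟩
        · exact h1 ⟨s, hs, s', hs', c, ((hxs.mono hTF').symm.trans
            (Rch.of_edge hgF hx.1 hy.1)).trans (hys.mono hTF')⟩
      have hone : (g ∩ vset (l0 ++ T)).card = 1 := by
        have b1 := Finset.card_le_one.2 huniq
        have b2 := Finset.card_pos.2 ⟨z, Finset.mem_inter.2 ⟨hz.2, hzV⟩⟩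
        omega
      have hassoc : l0 ++ (T ++ [g]) = (l0 ++ T) ++ [g] := by simp
      apply ih (T ++ [g])
      · rw [hassoc, List.nodup_append']
        refine ⟨hT1, by simp, ?_⟩
        intro f hf hf'
        simp at hf'
        subst hf'
        exact hg.2 hf
      · intro f hf
        rw [List.mem_append] at hf
        rcases hf with hf | hf
        · exact hT2 f hf
        · simp at hf; rw [hf]; exact hg.1
      · intro i hi hi'
        rw [hassoc] at hi' ⊢
        rw [List.length_append, List.length_singleton] at hi'
        by_cases c : i < (l0 ++ T).length
        · rw [goodAt_snoc_old c]; exact hT3 i hi c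
        · rw [show i = (l0 ++ T).length by omega, goodAt_snoc_new]; exact hone
      · intro v hv
        have hmono : T.toFinset ⊆ (T ++ [g]).toFinset := by
          intro f hf; rw [List.mem_toFinset] at hf ⊢; exact List.mem_append_left _ hf
        rw [vset_append, Finset.mem_union] at hv
        rcases hv with hv | hv
        · obtain ⟨s, hs, hr⟩ := hT4 v hv
          exact ⟨s, hs, hr.mono hmono⟩
        · obtain ⟨s, hs, hr⟩ := hreach z hzV
          refine ⟨s, hs, Rch.trans (Rch.of_edge (e := g) (by simp) ?_ hz.2) (hr.mono hmono)⟩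
          simpa [vset_cons, vset_nil] using hv
      · rw [hassoc, List.length_append, List.length_singleton]; omega
  exact main _ [] (by simpa using hnd) (by simp) (by intro i a b; simp at b; omega)
    (by simp [vset_nil]) rfl

theorem BF.reach {k : ℕ} {E : Finset (Finset V)} (H : BF k E) {e f : Finset V} (he : e ∈ E)
    (hf : f ∈ E) {u v : V} (hu : u ∈ e) (hv : v ∈ f) : Rch E u v := by
  classical
  set A := E.filter (fun e => ∃ w ∈ e, Rch E u w) with hA
  have hall : f ∈ A := by
    by_contra hfA
    obtain ⟨a, ha, b, hb, z, hz⟩ := H.hc A (Finset.filter_subset _ _)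
      ⟨e, Finset.mem_filter.2 ⟨he, u, hu, Relation.ReflTransGen.refl⟩⟩
      ⟨f, Finset.mem_sdiff.2 ⟨hf, hfA⟩⟩
    rw [Finset.mem_inter] at hz
    rw [Finset.mem_sdiff] at hb
    obtain ⟨haE, w, hw, hr⟩ := Finset.mem_filter.1 ha
    exact hb.2 (Finset.mem_filter.2 ⟨hb.1, z, hz.2, hr.trans (Rch.of_edge haE hw hz.1)⟩)
  obtain ⟨_, w, hw, hr⟩ := Finset.mem_filter.1 hall
  exact hr.trans (Rch.of_edge hf hw hv)

theorem LooseCycle.rch {C : List (Finset V)} (hC : LooseCycle C) {F : Finset (Finset V)}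
    (hF : ∀ e ∈ C, e ∈ F) {u v : V} (hu : u ∈ vset C) (hv : v ∈ vset C) : Rch F u v := by
  have h0 := hC.1
  have key : ∀ i, i < C.length → ∀ u ∈ C.getD i ∅, ∀ v ∈ C.getD 0 ∅, Rch F u v := by
    intro i
    induction i with
    | zero => intro hi u hu v hv; exact Rch.of_edge (hF _ (getD_mem_of_lt hi)) hu hv
    | succ i ih =>
      intro hi u hu v hv
      obtain ⟨w, hw⟩ := hC.chain i hi
      rw [Finset.mem_inter] at hw
      exact (Rch.of_edge (hF _ (getD_mem_of_lt hi)) hu hw.2).trans (ih (by omega) w hw.1 v hv)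
  obtain ⟨i, hi, hu⟩ := mem_vset_getD.1 hu
  obtain ⟨j, hj, hv⟩ := mem_vset_getD.1 hv
  obtain ⟨w, hw⟩ := hC.chain 0 (by omega)
  rw [Finset.mem_inter] at hw
  exact (key i hi u hu w hw.1).trans (key j hj v hv w hw.1).symm

theorem BF.core {k : ℕ} {E : Finset (Finset V)} (H : BF k E) {l0 : List (Finset V)}
    (hnd : l0.Nodup) (hne : l0 ≠ []) (hE : ∀ e ∈ l0, e ∈ E)
    (hl1 : ∀ g ∈ E, g ∉ l0 → (vset l0 ∩ g).card ≤ 1)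
    (hl2 : ∀ e ∈ E, e ∉ l0 → ∀ f ∈ E, f ∉ l0 → e ≠ f → (e ∩ f).card ≤ 1)
    (core1 : ∀ s ∈ vset l0, ∃ l, OPorLC k l ∧ (∀ e ∈ l, e ∈ l0) ∧ s ∈ vset l)
    (core2 : ∀ P x y, (∀ e ∈ P, e ∈ E ∧ e ∉ l0) → PathOn (vset l0) P x y → False) :
    ∃ T, (l0 ++ T).Nodup ∧ (l0 ++ T).toFinset = E ∧
      ∀ i, l0.length ≤ i → i < (l0 ++ T).length → GoodAt (l0 ++ T) i := by
  have hk := H.hk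
  have memF : ∀ e, e ∈ E \ l0.toFinset ↔ e ∈ E ∧ e ∉ l0 := by
    intro e; rw [Finset.mem_sdiff, List.mem_toFinset]
  have hF : ∀ e ∈ E \ l0.toFinset, ∀ f ∈ E \ l0.toFinset, e ≠ f → (e ∩ f).card ≤ 1 := by
    intro e he f hf
    rw [memF] at he hf
    exact hl2 e he.1 he.2 f hf.1 hf.2
  have hS : ¬ Closed' (E \ l0.toFinset) (vset l0) := by
    intro h
    obtain ⟨P, x, y, hP, hp⟩ := h.exists_path (fun f hf => hl1 f ((memF f).1 hf).1 ((memF f).1 hf).2) hF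
    exact core2 P x y (fun e he => (memF e).1 (hP e he)) hp
  apply H.extend hnd hne hE hS
  intro g hg hcl
  obtain ⟨P, x, y, hP, hp⟩ := hcl.exists_path
    (fun f hf => hF g hg f (Finset.mem_of_mem_erase hf) (Finset.ne_of_mem_erase hf).symm)
    (fun e he f hf => hF e (Finset.mem_of_mem_erase he) f (Finset.mem_of_mem_erase hf))
  have hC := hp.looseCycle
  set C := g :: P with hCdef
  have hCF : ∀ e ∈ C, e ∈ E \ l0.toFinset := by
    intro e he
    rw [hCdef, List.mem_cons] at he
    rcases he with rfl | he
    · exact hg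
    · exact Finset.mem_of_mem_erase (hP e he)
  have hCE : ∀ e ∈ C, e ∈ E := fun e he => ((memF e).1 (hCF e he)).1
  have hle : (vset C ∩ vset l0).card ≤ 1 := by
    rw [Finset.card_le_one]
    intro s hs s' hs'
    rw [Finset.mem_inter] at hs hs'
    by_contra hss
    exact hS ⟨s, hs.2, s', hs'.2, hss, hC.rch hCF hs.1 hs'.1⟩
  by_cases hem : (vset C ∩ vset l0).Nonempty
  · obtain ⟨s, hs⟩ := hem
    have hs' := Finset.mem_inter.1 hs
    obtain ⟨l, hl, hll, hsl⟩ := core1 s hs'.2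
    apply H.no_c2c_nil (Or.inr hC) hCE hl (fun e he => hE e (hll e he))
    have b1 : vset C ∩ vset l ⊆ vset C ∩ vset l0 := by
      apply Finset.inter_subset_inter_left
      intro v hv
      obtain ⟨e, he, hve⟩ := mem_vset.1 hv
      exact mem_vset.2 ⟨e, hll e he, hve⟩
    have b2 := Finset.card_le_card b1
    have b3 := Finset.card_pos.2 ⟨s, Finset.mem_inter.2 ⟨hs'.1, hsl⟩⟩
    omega
  · rw [Finset.not_nonempty_iff_eq_empty] at hem
    obtain ⟨a, ha⟩ := List.exists_mem_of_ne_nil _ hne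
    have hane : a.Nonempty := Finset.card_pos.1 (by rw [H.hu a (hE a ha)]; omega)
    obtain ⟨v, hv⟩ := hane
    have hxC : x ∈ vset C := subset_vset (e := g) (by simp [hCdef])
      (mem_of_inter_eq_singleton hp.2.2.2.1).2
    have hgE := ((memF g).1 hg).1
    have hr := H.reach hgE (hE a ha) (mem_of_inter_eq_singleton hp.2.2.2.1).2 hv
    have hvS : v ∈ vset l0 := mem_vset.2 ⟨a, ha, hv⟩
    have hex : ∃ m x y p, (x ∈ vset C ∧ y ∈ vset l0) ∧ Ch E x y m p := by
      rcases hr.exists_ch with h | ⟨m, p, h⟩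
      · exact (not_of_inter_eq_empty hem hxC (h ▸ hvS)).elim
      · exact ⟨m, x, v, p, ⟨hxC, hvS⟩, h⟩
    obtain ⟨m, u, w, p, ⟨huC, hwS⟩, hch, hmin⟩ := exists_shortest hex
    obtain ⟨a1, a2, a3, a4⟩ := hch.shortest (Q := fun x y => x ∈ vset C ∧ y ∈ vset l0) ⟨huC, hwS⟩ hmin
    obtain ⟨c1, c2, c3, c4, c5⟩ := hch
    -- the path avoids the core list
    have hnl : ∀ i < m, p i ∉ l0 := by
      intro i hi hpl
      have hsubS : p i ⊆ vset l0 := subset_vset hpl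
      by_cases c : i = 0
      · subst c; exact not_of_inter_eq_empty hem huC (hsubS c2)
      · obtain ⟨z, hz⟩ := c5 (i - 1) (by omega)
        rw [Finset.mem_inter, Nat.sub_add_cancel (by omega)] at hz
        exact a2 (i-1) z hz.1 (by omega) ⟨huC, hsubS hz.2⟩
    have hpC : ∀ i, 0 < i → i < m → p i ∩ vset C = ∅ := by
      intro i h0 hi
      rw [Finset.eq_empty_iff_forall_notMem]
      intro z hz
      rw [Finset.mem_inter] at hz
      exact a3 i z hz.1 h0 hi ⟨hz.2, hwS⟩
    have hpS : ∀ i, i + 1 < m → p i ∩ vset l0 = ∅ := by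
      intro i hi
      rw [Finset.eq_empty_iff_forall_notMem]
      intro z hz
      rw [Finset.mem_inter] at hz
      exact a2 i z hz.1 hi ⟨huC, hz.2⟩
    obtain ⟨l, hl, hll, hwl⟩ := core1 w hwS
    have hlsub : vset l ⊆ vset l0 := by
      intro v hv
      obtain ⟨e, he, hve⟩ := mem_vset.1 hv
      exact mem_vset.2 ⟨e, hll e he, hve⟩
    have hp0 : ¬ p 0 ⊆ vset C := by
      intro hsub
      by_cases c : m = 1
      · subst c; exact not_of_inter_eq_empty hem (hsub c3) hwS
      · obtain ⟨z, hz⟩ := c5 0 (by omega)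
        rw [Finset.mem_inter] at hz
        exact not_of_inter_eq_empty (hpC 1 (by omega) (by omega)) hz.2 (hsub hz.1)
    have hp0C : p 0 ∉ C := fun h => hp0 (subset_vset h)
    have hone : (p 0 ∩ vset C).card = 1 := by
      have b1 := Finset.card_pos.2 ⟨u, Finset.mem_inter.2 ⟨c2, huC⟩⟩
      by_contra hcon
      exact hp0 (H.handle (Or.inr hC) hCE (c4 0 (by omega)) hp0C (by omega))
    apply H.no_c2c_path (P := mkL p m) (Or.inr hC) hCE hl (fun e he => hE e (hll e he))
    · apply mkL_loosePath c1
      · intro i hi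
        apply Finset.card_pos.1
        rw [H.hu _ (c4 i hi)]; omega
      · exact a1
      · intro i hi
        have b1 := hl2 _ (c4 i (by omega)) (hnl i (by omega)) _ (c4 (i+1) hi) (hnl _ hi) (a4 i hi)
        have b2 := Finset.card_pos.2 (c5 i hi)
        omega
      · exact a4
    · intro e he
      obtain ⟨i, hi, rfl⟩ := mem_mkL.1 he
      exact c4 i hi
    · exact Finset.subset_empty.1 ((Finset.inter_subset_inter_left hlsub).trans hem.subset)
    · rw [mkL_getD (by omega)]; exact hone
    · rw [mkL_length, mkL_getD (by omega)]
      have b1 := hl1 _ (c4 (m-1) (by omega)) (hnl (m-1) (by omega))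
      have b2 := Finset.card_pos.2 ⟨w, Finset.mem_inter.2 ⟨c3, hwl⟩⟩
      have b3 : p (m-1) ∩ vset l ⊆ vset l0 ∩ p (m-1) := by
        rw [Finset.inter_comm]; exact Finset.inter_subset_inter_right hlsub
      have b4 := Finset.card_le_card b3
      omega
    · intro i h0 hi
      rw [mkL_length] at hi
      rw [mkL_getD hi]; exact hpC i h0 hi
    · intro i hi
      rw [mkL_length] at hi
      rw [mkL_getD (by omega)]
      exact Finset.subset_empty.1 ((Finset.inter_subset_inter_left hlsub).trans (hpS i hi).subset)

theorem BF.op_link1 {k : ℕ} {E : Finset (Finset V)} (H : BF k E) {e f g : Finset V}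
    (h : IsOP E e f) (hg : g ∈ E) (hU : g ⊆ e ∪ f) (hge : g ≠ e) :
    IsOP E e g ∧ e ∪ g = e ∪ f := by
  by_cases hgf : g = f
  · subst hgf; exact ⟨h, rfl⟩
  have hk := H.hk
  obtain ⟨he, hf, hne, h2⟩ := h
  have key : 2 ≤ (e ∩ g).card := by
    by_contra hlt
    have c1 := H.hu _ he
    have c2 := H.hu _ hf
    have c3 := H.hu _ hg
    have d1 : g.card ≤ (e ∩ g).card + (g ∩ f).card := by
      refine le_trans (Finset.card_le_card ?_) (Finset.card_union_le _ _)
      intro x hx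
      have := hU hx
      simp only [Finset.mem_union, Finset.mem_inter] at this ⊢
      tauto
    have hop : IsOP E g f := ⟨hg, hf, hgf, by omega⟩
    have d2 : e ⊆ g ∪ f := H.op_handle hop he (le_trans h2 (Finset.card_le_card (by
      intro x hx; simp only [Finset.mem_union, Finset.mem_inter] at hx ⊢; tauto)))
    have d3 : (e \ f).card ≤ (e ∩ g).card := Finset.card_le_card (by
      intro x hx
      rw [Finset.mem_sdiff] at hx
      have := d2 hx.1
      simp only [Finset.mem_union, Finset.mem_inter] at this ⊢; tauto)
    have d4 := Finset.card_sdiff_add_card_inter e f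
    have d5 := Finset.card_sdiff_add_card_inter f e
    rw [Finset.inter_comm f e] at d5
    have d6 : g.card ≤ (e ∩ g).card + (f \ e).card := by
      refine le_trans (Finset.card_le_card ?_) (Finset.card_union_le _ _)
      intro x hx
      have := hU hx
      simp only [Finset.mem_union, Finset.mem_inter, Finset.mem_sdiff] at this ⊢
      tauto
    omega
  have hop : IsOP E e g := ⟨he, hg, fun h => hge h.symm, key⟩
  refine ⟨hop, Finset.Subset.antisymm (Finset.union_subset Finset.subset_union_left hU) ?_⟩
  refine Finset.union_subset Finset.subset_union_left ?_
  refine H.op_handle hop hf (le_trans h2 (Finset.card_le_card ?_))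
  intro x hx; simp only [Finset.mem_union, Finset.mem_inter] at hx ⊢; tauto

theorem BF.op_link {k : ℕ} {E : Finset (Finset V)} (H : BF k E) {e f g h : Finset V}
    (hop : IsOP E e f) (hg : g ∈ E) (hU : g ⊆ e ∪ f) (hh : h ∈ E) (hhU : h ⊆ e ∪ f)
    (hgh : g ≠ h) : IsOP E g h ∧ g ∪ h = e ∪ f := by
  by_cases c : g = e
  · subst c
    exact H.op_link1 hop hh hhU (fun h => hgh h.symm)
  · obtain ⟨a1, a2⟩ := H.op_link1 hop hg hU c
    rw [← a2, Finset.union_comm e g]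
    rw [← a2, Finset.union_comm e g] at hhU
    have := H.op_link1 a1.symm hh hhU (fun h => hgh h.symm)
    exact this

theorem BF.op_out {k : ℕ} {E : Finset (Finset V)} (H : BF k E) {e f g : Finset V}
    (hop : IsOP E e f) (hg : g ∈ E) (hU : ¬ g ⊆ e ∪ f) : (g ∩ (e ∪ f)).card ≤ 1 := by
  by_contra h
  exact hU (H.op_handle hop hg (by omega))

theorem IsOP.oplc {k : ℕ} {E : Finset (Finset V)} (H : BF k E) {e f : Finset V}
    (hop : IsOP E e f) : OPorLC k [e, f] := Or.inl (H.overlapPair hop)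

theorem IsOP.mem {E : Finset (Finset V)} {e f : Finset V}
    (hop : IsOP E e f) : ∀ g ∈ [e, f], g ∈ E := by
  intro g hg
  simp only [List.mem_cons, List.not_mem_nil, or_false] at hg
  rcases hg with rfl | rfl
  · exact hop.1
  · exact hop.2.1

theorem BF.op_inter_ne_one {k : ℕ} {E : Finset (Finset V)} (H : BF k E) {e f e' f' : Finset V}
    (h : IsOP E e f) (h' : IsOP E e' f') : ((e ∪ f) ∩ (e' ∪ f')).card ≠ 1 := by
  intro hc
  rw [← vset_pair, ← vset_pair] at hc
  exact H.no_c2c_nil (h.oplc H) h.mem (h'.oplc H) h'.mem hc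

/-- Two overlapping pairs are never disjoint. -/
theorem BF.op_not_disj {k : ℕ} {E : Finset (Finset V)} (H : BF k E) {e f e' f' : Finset V}
    (h : IsOP E e f) (h' : IsOP E e' f') : (e ∪ f) ∩ (e' ∪ f') ≠ ∅ := by
  intro hdis
  have hk := H.hk
  let Q : V → V → Prop := fun x y => ∃ e f e' f', IsOP E e f ∧ IsOP E e' f' ∧ x ∈ e ∪ f ∧
    y ∈ e' ∪ f' ∧ (e ∪ f) ∩ (e' ∪ f') = ∅
  have hex : ∃ m x y p, Q x y ∧ Ch E x y m p := by
    have ne1 : e.Nonempty := Finset.card_pos.1 (by rw [H.hu _ h.1]; omega)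
    have ne2 : e'.Nonempty := Finset.card_pos.1 (by rw [H.hu _ h'.1]; omega)
    obtain ⟨x, hx⟩ := ne1
    obtain ⟨y, hy⟩ := ne2
    have hQ : Q x y := ⟨e, f, e', f', h, h', Finset.mem_union_left _ hx,
      Finset.mem_union_left _ hy, hdis⟩
    rcases (H.reach h.1 h'.1 hx hy).exists_ch with hh | ⟨m, p, hh⟩
    · subst hh
      exact (not_of_inter_eq_empty hdis (Finset.mem_union_left _ hx)
        (Finset.mem_union_left _ hy)).elim
    · exact ⟨m, x, y, p, hQ, hh⟩
  obtain ⟨m, x, y, p, hQ, hc, hmin⟩ := exists_shortest hex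
  obtain ⟨a1, a2, a3, a4⟩ := hc.shortest (Q := Q) hQ hmin
  obtain ⟨e, f, e', f', h, h', hx, hy, hdis⟩ := hQ
  obtain ⟨h1, h2, h3, h4, h5⟩ := hc
  have nU : ∀ i z, z ∈ p i → 0 < i → i < m → z ∉ e ∪ f := fun i z hz hi him hzU =>
    a3 i z hz hi him ⟨e, f, e', f', h, h', hzU, hy, hdis⟩
  have nU' : ∀ i z, z ∈ p i → i + 1 < m → z ∉ e' ∪ f' := fun i z hz hi hzU =>
    a2 i z hz hi ⟨e, f, e', f', h, h', hx, hzU, hdis⟩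
  have p0 : ¬ p 0 ⊆ e ∪ f := by
    intro hs
    by_cases c : 1 < m
    · obtain ⟨z, hz⟩ := h5 0 c
      rw [Finset.mem_inter] at hz
      exact nU 1 z hz.2 (by omega) c (hs hz.1)
    · have : m = 1 := by omega
      subst this
      exact not_of_inter_eq_empty hdis (hs h3) hy
  have pl : ¬ p (m-1) ⊆ e' ∪ f' := by
    intro hs
    by_cases c : 1 < m
    · obtain ⟨z, hz⟩ := h5 (m-2) (by omega)
      rw [Finset.mem_inter, show m - 2 + 1 = m - 1 by omega] at hz
      exact nU' (m-2) z hz.1 (by omega) (hs hz.2)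
    · have : m = 1 := by omega
      subst this
      exact not_of_inter_eq_empty hdis hx (hs h2)
  have p0c : (p 0 ∩ (e ∪ f)).card = 1 := by
    have b1 := H.op_out h (h4 0 (by omega)) p0
    have b2 : 0 < (p 0 ∩ (e ∪ f)).card := Finset.card_pos.2 ⟨x, Finset.mem_inter.2 ⟨h2, hx⟩⟩
    omega
  have plc : (p (m-1) ∩ (e' ∪ f')).card = 1 := by
    have b1 := H.op_out h' (h4 (m-1) (by omega)) pl
    have b2 : 0 < (p (m-1) ∩ (e' ∪ f')).card := Finset.card_pos.2 ⟨y, Finset.mem_inter.2 ⟨h3, hy⟩⟩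
    omega
  have hlin : ∀ i, i + 1 < m → (p i ∩ p (i+1)).card = 1 := by
    intro i hi
    have b2 : 0 < (p i ∩ p (i+1)).card := Finset.card_pos.2 (h5 i hi)
    by_contra hcard
    have hop : IsOP E (p i) (p (i+1)) := ⟨h4 i (by omega), h4 (i+1) hi, a4 i hi, by omega⟩
    by_cases c : i = 0
    · subst c
      apply H.op_inter_ne_one hop h
      refine Eq.trans (congrArg Finset.card ?_) p0c
      ext z
      simp only [Finset.mem_inter, Finset.mem_union (s := p 0)]
      constructor
      · rintro ⟨hz | hz, hz2⟩
        · exact ⟨hz, hz2⟩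
        · exact (nU _ z hz (by omega) hi hz2).elim
      · rintro ⟨hz, hz2⟩; exact ⟨Or.inl hz, hz2⟩
    · obtain ⟨z, hz⟩ := h5 i hi
      rw [Finset.mem_inter] at hz
      refine a2 i z hz.1 hi ⟨e, f, p i, p (i+1), h, hop, hx, Finset.mem_union_left _ hz.1, ?_⟩
      rw [Finset.eq_empty_iff_forall_notMem]
      intro w hw
      rw [Finset.mem_inter, Finset.mem_union (s := p i)] at hw
      rcases hw with ⟨hw, hw' | hw'⟩
      · exact nU i w hw' (by omega) (by omega) hw
      · exact nU _ w hw' (by omega) hi hw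
  have hpath : LoosePath (mkL p m) := by
    apply mkL_loosePath h1
    · intro i hi
      by_cases c : i + 1 < m
      · exact (h5 i c).mono Finset.inter_subset_left
      · exact ⟨y, by rw [show i = m - 1 by omega]; exact h3⟩
    · exact a1
    · exact hlin
    · exact a4
  refine H.no_c2c_path (h.oplc H) h.mem (h'.oplc H) h'.mem hpath ?_ ?_ ?_ ?_ ?_ ?_
  · intro g hg
    obtain ⟨i, hi, rfl⟩ := mem_mkL.1 hg
    exact h4 i hi
  · rw [vset_pair, vset_pair]; exact hdis
  · rw [vset_pair, mkL_getD (by omega)]; exact p0c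
  · rw [vset_pair, mkL_length, mkL_getD (by omega)]; exact plc
  · intro i hi him
    rw [mkL_length] at him
    rw [vset_pair, mkL_getD him, Finset.eq_empty_iff_forall_notMem]
    intro z hz
    rw [Finset.mem_inter] at hz
    exact nU i z hz.1 hi him hz.2
  · intro i him
    rw [mkL_length] at him
    rw [vset_pair, mkL_getD (by omega), Finset.eq_empty_iff_forall_notMem]
    intro z hz
    rw [Finset.mem_inter] at hz
    exact nU' i z hz.1 him hz.2

theorem BF.op_two_aux {k : ℕ} {E : Finset (Finset V)} (H : BF k E) {e f e' f' : Finset V}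
    (h : IsOP E e f) (h' : IsOP E e' f') (hU : e ∪ f ≠ e' ∪ f') :
    (e' ∩ (e ∪ f)).card ≤ 1 ∧ (f' ∩ (e ∪ f)).card ≤ 1 := by
  have main : ∀ {e' f' : Finset V}, IsOP E e' f' → e ∪ f ≠ e' ∪ f' → (e' ∩ (e ∪ f)).card ≤ 1 := by
    intro e' f' h' hU
    apply H.op_out h h'.1
    intro hs
    have h2 : f' ⊆ e ∪ f := H.op_handle h h'.2.1 (le_trans h'.2.2.2 (Finset.card_le_card (by
      intro x hx
      rw [Finset.mem_inter] at hx ⊢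
      exact ⟨hx.2, hs hx.1⟩)))
    exact hU (H.op_link h h'.1 hs h'.2.1 h2 h'.2.2.1).2.symm
  exact ⟨main h' hU, main h'.symm (by rw [Finset.union_comm f']; exact hU)⟩

/-- Two overlapping pairs with different unions. -/
theorem BF.op_two {k : ℕ} {E : Finset (Finset V)} (H : BF k E) {e f e' f' : Finset V}
    (h : IsOP E e f) (h' : IsOP E e' f') (hU : e ∪ f ≠ e' ∪ f') :
    ∃ x y, x ≠ y ∧ (e ∪ f) ∩ (e' ∪ f') = {x, y} ∧ x ∈ e \ f ∧ y ∈ f \ e ∧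
      ((x ∈ e' \ f' ∧ y ∈ f' \ e') ∨ (x ∈ f' \ e' ∧ y ∈ e' \ f')) ∧
      (e ∩ f).card = k - 1 ∧ (e' ∩ f').card = k - 1 := by
  obtain ⟨a1, a2⟩ := H.op_two_aux h h' hU
  obtain ⟨b1, b2⟩ := H.op_two_aux h' h hU.symm
  have hle : ((e ∪ f) ∩ (e' ∪ f')).card = 2 := by
    have c1 := H.op_inter_ne_one h h'
    have c2 : ((e ∪ f) ∩ (e' ∪ f')).card ≠ 0 := by
      rw [Ne, Finset.card_eq_zero]; exact H.op_not_disj h h'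
    have c3 : ((e ∪ f) ∩ (e' ∪ f')).card ≤ (e' ∩ (e ∪ f)).card + (f' ∩ (e ∪ f)).card := by
      refine le_trans (Finset.card_le_card ?_) (Finset.card_union_le _ _)
      intro x hx
      simp only [Finset.mem_union, Finset.mem_inter] at hx ⊢; tauto
    omega
  obtain ⟨x, y, hxy, hi⟩ := Finset.card_eq_two.1 hle
  have hx : x ∈ (e ∪ f) ∩ (e' ∪ f') := by rw [hi]; simp
  have hy : y ∈ (e ∪ f) ∩ (e' ∪ f') := by rw [hi]; simp
  rw [Finset.mem_inter] at hx hy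
  have n1 : ¬ (x ∈ e ∧ y ∈ e) := fun hh => hxy (eq_of_card_inter_le_one b1 hh.1 hx.2 hh.2 hy.2)
  have n2 : ¬ (x ∈ f ∧ y ∈ f) := fun hh => hxy (eq_of_card_inter_le_one b2 hh.1 hx.2 hh.2 hy.2)
  have n3 : ¬ (x ∈ e' ∧ y ∈ e') := fun hh => hxy (eq_of_card_inter_le_one a1 hh.1 hx.1 hh.2 hy.1)
  have n4 : ¬ (x ∈ f' ∧ y ∈ f') := fun hh => hxy (eq_of_card_inter_le_one a2 hh.1 hx.1 hh.2 hy.1)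
  have main : ∀ {e f e' f' : Finset V} {x y : V}, IsOP E e f → IsOP E e' f' → x ≠ y →
      (e ∪ f) ∩ (e' ∪ f') = {x, y} → x ∈ e \ f → y ∈ f \ e →
      ((x ∈ e' \ f' ∧ y ∈ f' \ e') ∨ (x ∈ f' \ e' ∧ y ∈ e' \ f')) → (e' ∩ f').card = k - 1 := by
    intro e f e' f' x y h h' hxy hi hx hy hh
    have c1 := inter_card_lt (H.hu _ h'.1) (H.hu _ h'.2.1) h'.2.2.1
    by_contra hne
    have c2 : (e' ∩ f').card ≤ k - 2 := by omega
    rcases hh with ⟨hx', hy'⟩ | ⟨hx', hy'⟩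
    · rw [Finset.union_comm e'] at hi
      exact H.no_double_op h h'.symm hxy hi hx hx' hy hy' (by rw [Finset.inter_comm]; exact c2)
    · exact H.no_double_op h h' hxy hi hx hx' hy hy' c2
  simp only [Finset.mem_union] at hx hy
  have fin : ∀ x y, x ≠ y → (e ∪ f) ∩ (e' ∪ f') = {x, y} → x ∈ e \ f → y ∈ f \ e →
      ((x ∈ e' \ f' ∧ y ∈ f' \ e') ∨ (x ∈ f' \ e' ∧ y ∈ e' \ f')) →
      ∃ x y, x ≠ y ∧ (e ∪ f) ∩ (e' ∪ f') = {x, y} ∧ x ∈ e \ f ∧ y ∈ f \ e ∧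
      ((x ∈ e' \ f' ∧ y ∈ f' \ e') ∨ (x ∈ f' \ e' ∧ y ∈ e' \ f')) ∧
      (e ∩ f).card = k - 1 ∧ (e' ∩ f').card = k - 1 := by
    intro x y hxy hi hx hy hh
    refine ⟨x, y, hxy, hi, hx, hy, hh, ?_, main h h' hxy hi hx hy hh⟩
    rcases hh with ⟨hx', hy'⟩ | ⟨hx', hy'⟩
    · exact main h' h hxy (by rw [Finset.inter_comm]; exact hi) hx' hy' (Or.inl ⟨hx, hy⟩)
    · refine main h'.symm h hxy ?_ hx' hy' (Or.inl ⟨hx, hy⟩)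
      rw [Finset.inter_comm, Finset.union_comm f']; exact hi
  clear main h h' hU a1 a2 b1 b2 hle H
  by_cases c : x ∈ e
  · have d1 : y ∉ e := fun hh => n1 ⟨c, hh⟩
    have d2 : y ∈ f := hy.1.resolve_left d1
    have d3 : x ∉ f := fun hh => n2 ⟨hh, d2⟩
    refine fin x y hxy hi (Finset.mem_sdiff.2 ⟨c, d3⟩) (Finset.mem_sdiff.2 ⟨d2, d1⟩) ?_
    clear fin hi
    simp only [Finset.mem_sdiff]; tauto
  · have d1 : x ∈ f := hx.1.resolve_left c
    have d2 : y ∉ f := fun hh => n2 ⟨d1, hh⟩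
    have d3 : y ∈ e := hy.1.resolve_right d2
    refine fin y x hxy.symm (by rw [hi, Finset.pair_comm]) (Finset.mem_sdiff.2 ⟨d3, d2⟩)
      (Finset.mem_sdiff.2 ⟨d1, c⟩) ?_
    clear fin hi
    simp only [Finset.mem_sdiff]; tauto

/-- No path outside closing up a link. -/
theorem BF.link_core {k : ℕ} {E : Finset (Finset V)} (H : BF k E) {e f : Finset V}
    (h : IsOP E e f) {P : List (Finset V)} {x y : V} (hP : ∀ p ∈ P, p ∈ E)
    (hp : PathOn (e ∪ f) P x y) : False := by
  have hx := (mem_of_inter_eq_singleton hp.2.2.2.1)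
  have hy := (mem_of_inter_eq_singleton hp.2.2.2.2.1)
  have hk := H.hk
  have main : ∀ {e f : Finset V}, IsOP E e f → PathOn (e ∪ f) P x y → x ∈ e → y ∈ e → False := by
    intro e f h hp hxe hye
    have hp' : PathOn e P x y := hp.mono Finset.subset_union_left hxe hye
    have hC := hp'.looseCycle
    have hfP : f ∉ P := by
      intro hfP
      have : f ∩ (e ∪ f) ⊆ {x, y} := by
        rw [← hp.inter]
        intro z hz
        rw [Finset.mem_inter] at hz ⊢
        exact ⟨hz.2, subset_vset hfP hz.1⟩
      have c := Finset.card_le_card this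
      rw [Finset.inter_eq_left.2 Finset.subset_union_right, H.hu _ h.2.1] at c
      have := Finset.card_le_two (a := x) (b := y)
      omega
    have hf : f ⊆ vset (e :: P) := by
      refine H.handle (Or.inr hC) ?_ h.2.1 ?_ ?_
      · intro g hg
        rcases List.mem_cons.1 hg with rfl | hg
        · exact h.1
        · exact hP g hg
      · rw [List.mem_cons]
        rintro (hh | hh)
        · exact h.2.2.1 hh.symm
        · exact hfP hh
      · refine le_trans h.2.2.2 (Finset.card_le_card ?_)
        intro z hz
        rw [Finset.mem_inter] at hz ⊢
        exact ⟨hz.2, subset_vset (List.mem_cons_self) hz.1⟩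
    have : f ⊆ e := by
      intro z hz
      have := hf hz
      rw [vset_cons, Finset.mem_union] at this
      rcases this with hh | hh
      · exact hh
      · have : z ∈ (e ∪ f) ∩ vset P := Finset.mem_inter.2 ⟨Finset.mem_union_right _ hz, hh⟩
        rw [hp.inter, Finset.mem_insert, Finset.mem_singleton] at this
        rcases this with rfl | rfl
        · exact hxe
        · exact hye
    exact h.2.2.1 (Finset.eq_of_subset_of_card_le this
      (by rw [H.hu _ h.1, H.hu _ h.2.1])).symm
  have hp2 : PathOn (f ∪ e) P x y := by rw [Finset.union_comm]; exact hp
  have hx' := hx.2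
  have hy' := hy.2
  rw [Finset.mem_union] at hx' hy'
  have n1 := main h hp
  have n2 := main h.symm hp2
  by_cases c : x ∈ e
  · exact H.no_spoiled h.symm hP hp2 (by rw [Finset.mem_sdiff]; tauto) (by rw [Finset.mem_sdiff]; tauto)
  · exact H.no_spoiled h hP hp (by rw [Finset.mem_sdiff]; tauto) (by rw [Finset.mem_sdiff]; tauto)

/-- The six alternatives for the initial segment. -/
def Alt (k : ℕ) (l : List (Finset V)) : Prop :=
  l.length = 1 ∨ LooseCycle l ∨ OverlapPair k l ∨ (k = 3 ∧ Pasch l) ∨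
    (∃ u, 2 ≤ u ∧ StarKU2 k u l) ∨
    (3 ≤ l.length ∧ ∃ d ≤ k / (l.length - 1), KLink k l.length d l)

/-- The conclusion, before exclusivity. -/
def Concl (k : ℕ) (E : Finset (Finset V)) : Prop :=
  ∃ l0 T : List (Finset V), (l0 ++ T).Nodup ∧ (l0 ++ T).toFinset = E ∧
    (∀ i, l0.length ≤ i → i < (l0 ++ T).length → GoodAt (l0 ++ T) i) ∧ Alt k l0

theorem allowed_of_pairs {l : List (Finset V)} (hnd : l.Nodup)
    (h : ∀ i j, i < j → j < l.length → (l.getD i ∅ ∩ l.getD j ∅).Nonempty) : Allowed l := by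
  refine ⟨hnd, ?_⟩
  intro i hi hil
  obtain ⟨z, hz⟩ := h 0 i hi hil
  rw [Finset.mem_inter] at hz
  apply Finset.card_pos.2
  exact ⟨z, mem_oldOf.2 ⟨hz.2, 0, hi, by omega, hz.1⟩⟩

theorem BF.case_link {k : ℕ} {E : Finset (Finset V)} (H : BF k E) {e f : Finset V}
    (h : IsOP E e f) (hall : ∀ e' f', IsOP E e' f' → e' ∪ f' = e ∪ f) : Concl k E := by
  classical
  have hk := H.hk
  set L := E.filter (· ⊆ e ∪ f) with hL
  have hmem : ∀ g, g ∈ L.toList ↔ g ∈ E ∧ g ⊆ e ∪ f := by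
    intro g; rw [Finset.mem_toList, hL, Finset.mem_filter]
  have heL : e ∈ L.toList := (hmem e).2 ⟨h.1, Finset.subset_union_left⟩
  have hfL : f ∈ L.toList := (hmem f).2 ⟨h.2.1, Finset.subset_union_right⟩
  have hv : vset L.toList = e ∪ f := by
    apply Finset.Subset.antisymm
    · intro z hz
      obtain ⟨g, hg, hzg⟩ := mem_vset.1 hz
      exact ((hmem g).1 hg).2 hzg
    · exact Finset.union_subset (subset_vset heL) (subset_vset hfL)
  have hpair : ∀ i j, i < j → j < L.toList.length →
      IsOP E (L.toList.getD i ∅) (L.toList.getD j ∅) ∧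
        L.toList.getD i ∅ ∪ L.toList.getD j ∅ = e ∪ f := by
    intro i j hij hj
    have m1 := (hmem _).1 (getD_mem_of_lt (l := L.toList) (i := i) (by omega))
    have m2 := (hmem _).1 (getD_mem_of_lt (l := L.toList) (i := j) hj)
    refine H.op_link h m1.1 m1.2 m2.1 m2.2 ?_
    rw [List.getD_eq_getElem _ _ (by omega), List.getD_eq_getElem _ _ hj]
    intro hh
    have := (List.Nodup.getElem_inj_iff L.nodup_toList).1 hh
    omega
  obtain ⟨T, hT1, hT2, hT3⟩ := H.core (l0 := L.toList) L.nodup_toList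
    (List.ne_nil_of_mem heL) (fun g hg => ((hmem g).1 hg).1)
    (by
      intro g hg hgL
      rw [hv, Finset.inter_comm]
      exact H.op_out h hg (fun hs => hgL ((hmem g).2 ⟨hg, hs⟩)))
    (by
      intro a ha haL b hb hbL hab
      by_contra hc
      have := hall a b ⟨ha, hb, hab, by omega⟩
      exact haL ((hmem a).2 ⟨ha, by rw [← this]; exact Finset.subset_union_left⟩))
    (by
      intro s hs
      rw [hv] at hs
      refine ⟨[e, f], h.oplc H, ?_, by rw [vset_pair]; exact hs⟩
      intro g hg
      simp only [List.mem_cons, List.not_mem_nil, or_false] at hg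
      rcases hg with rfl | rfl
      · exact heL
      · exact hfL)
    (by
      intro P x y hP hp
      rw [hv] at hp
      exact H.link_core h (fun p hp => (hP p hp).1) hp)
  refine ⟨L.toList, T, hT1, hT2, hT3, ?_⟩
  have hlen : 2 ≤ L.toList.length := by
    rw [Finset.length_toList]
    apply Finset.one_lt_card.2
    exact ⟨e, Finset.mem_toList.1 heL, f, Finset.mem_toList.1 hfL, h.2.2.1⟩
  by_cases c : L.toList.length = 2
  · obtain ⟨a, b, hab⟩ := List.length_eq_two.1 c
    right; right; left
    have := (hpair 0 1 (by omega) (by omega)).1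
    rw [hab] at this ⊢
    exact H.overlapPair this
  · right; right; right; right; right
    refine ⟨by omega, (e ∪ f).card - k, ?_, ?_⟩
    · rw [Nat.le_div_iff_mul_le (by omega)]
      have hs : ∑ g ∈ L, ((e ∪ f) \ g).card = (L.biUnion (fun g => (e ∪ f) \ g)).card := by
        rw [Finset.card_biUnion]
        intro a ha b hb hab
        show Disjoint ((e ∪ f) \ a) ((e ∪ f) \ b)
        rw [Finset.disjoint_left]
        intro z hz hz'
        rw [Finset.mem_coe, hL, Finset.mem_filter] at ha hb
        have := (H.op_link h ha.1 ha.2 hb.1 hb.2 hab).2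
        rw [Finset.mem_sdiff] at hz hz'
        have h1 := hz.1
        rw [← this, Finset.mem_union] at h1
        exact h1.elim hz.2 hz'.2
      have hs2 : ∑ g ∈ L, ((e ∪ f) \ g).card = L.card * ((e ∪ f).card - k) := by
        rw [Finset.sum_const_nat]
        intro g hg
        rw [hL, Finset.mem_filter] at hg
        rw [Finset.card_sdiff_of_subset hg.2, H.hu _ hg.1]
      have hs3 : (L.biUnion (fun g => (e ∪ f) \ g)).card ≤ (e ∪ f).card := by
        apply Finset.card_le_card
        apply Finset.biUnion_subset.2
        intro g _
        exact Finset.sdiff_subset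
      have hs4 : k ≤ (e ∪ f).card := by
        rw [← H.hu _ h.1]; exact Finset.card_le_card Finset.subset_union_left
      rw [Finset.length_toList] at hlen ⊢
      obtain ⟨n, hn⟩ : ∃ n, L.card = n + 1 := ⟨L.card - 1, by omega⟩
      rw [hn, add_mul] at hs2
      rw [hn, Nat.add_sub_cancel, mul_comm]
      omega
    · have hs4 : k ≤ (e ∪ f).card := by
        rw [← H.hu _ h.1]; exact Finset.card_le_card Finset.subset_union_left
      refine ⟨allowed_of_pairs L.nodup_toList ?_, rfl, ?_, ?_⟩
      · intro i j hij hj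
        have := (hpair i j hij hj).1.2.2.2
        exact Finset.card_pos.1 (by omega)
      · rw [hv]; omega
      · intro i j hij hj
        rw [(hpair i j hij hj).2]; omega

theorem cover_of_three {a b c d : Finset V} (ha : a.card = 3) (hb : (a ∩ b).card = 1)
    (hc : (a ∩ c).card = 1) (hd : (a ∩ d).card = 1) (h1 : ∀ z, z ∈ a → z ∈ b → z ∉ c)
    (h2 : ∀ z, z ∈ a → z ∈ b → z ∉ d) (h3 : ∀ z, z ∈ a → z ∈ c → z ∉ d) :
    ∀ z ∈ a, z ∈ b ∨ z ∈ c ∨ z ∈ d := by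
  have e1 : (a ∩ b ∪ a ∩ c).card = 2 := by
    rw [Finset.card_union_of_disjoint, hb, hc]
    rw [Finset.disjoint_left]
    intro z hz hz'
    rw [Finset.mem_inter] at hz hz'
    exact h1 z hz.1 hz.2 hz'.2
  have e2 : (a ∩ b ∪ a ∩ c ∪ a ∩ d).card = 3 := by
    rw [Finset.card_union_of_disjoint, e1, hd]
    rw [Finset.disjoint_left]
    intro z hz hz'
    rw [Finset.mem_union, Finset.mem_inter, Finset.mem_inter] at hz
    rw [Finset.mem_inter] at hz'
    rcases hz with hz | hz
    · exact h2 z hz.1 hz.2 hz'.2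
    · exact h3 z hz.1 hz.2 hz'.2
  have e3 : a ∩ b ∪ a ∩ c ∪ a ∩ d = a := by
    apply Finset.eq_of_subset_of_card_le
    · intro z hz
      simp only [Finset.mem_union, Finset.mem_inter] at hz
      tauto
    · rw [e2, ha]
  intro z hz
  rw [← e3] at hz
  simp only [Finset.mem_union, Finset.mem_inter] at hz
  tauto

theorem pasch_of {a b c d : Finset V} (hnd : [a, b, c, d].Nodup)
    (ca : a.card = 3) (cb : b.card = 3) (cc : c.card = 3) (cd : d.card = 3)
    (ab : (a ∩ b).card = 1) (ac : (a ∩ c).card = 1) (ad : (a ∩ d).card = 1)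
    (bc : (b ∩ c).card = 1) (bd : (b ∩ d).card = 1) (cd' : (c ∩ d).card = 1)
    (t1 : ∀ z, z ∈ a → z ∈ b → z ∉ c) (t2 : ∀ z, z ∈ a → z ∈ b → z ∉ d)
    (t3 : ∀ z, z ∈ a → z ∈ c → z ∉ d) (t4 : ∀ z, z ∈ b → z ∈ c → z ∉ d) : Pasch [a, b, c, d] := by
  have pairs : ∀ i j, i < j → j < 4 →
      (([a, b, c, d] : List (Finset V)).getD i ∅ ∩ [a, b, c, d].getD j ∅).card = 1 := by
    intro i j hij hj
    interval_cases j <;> interval_cases i <;> simpa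
  have A := cover_of_three ca ab ac ad t1 t2 t3
  have B := cover_of_three (a := b) (b := a) (c := c) (d := d) cb (by rw [Finset.inter_comm]; exact ab)
    bc bd (fun z h1 h2 => t1 z h2 h1) (fun z h1 h2 => t2 z h2 h1) t4
  have C := cover_of_three (a := c) (b := a) (c := b) (d := d) cc (by rw [Finset.inter_comm]; exact ac)
    (by rw [Finset.inter_comm]; exact bc) cd' (fun z h1 h2 h3 => t1 z h2 h3 h1)
    (fun z h1 h2 => t3 z h2 h1) (fun z h1 h2 => t4 z h2 h1)
  have D := cover_of_three (a := d) (b := a) (c := b) (d := c) cd (by rw [Finset.inter_comm]; exact ad)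
    (by rw [Finset.inter_comm]; exact bd) (by rw [Finset.inter_comm]; exact cd')
    (fun z h1 h2 h3 => t2 z h2 h3 h1) (fun z h1 h2 h3 => t3 z h2 h3 h1)
    (fun z h1 h2 h3 => t4 z h2 h3 h1)
  have hv : ∀ z, z ∈ vset [a, b, c, d] ↔ z ∈ a ∨ z ∈ b ∨ z ∈ c ∨ z ∈ d := by
    intro z
    rw [mem_vset]; simp
  refine ⟨allowed_of_pairs hnd ?_, rfl, ?_, ?_, pairs⟩
  · intro i j hij hj
    exact Finset.card_pos.1 (by rw [pairs i j hij hj]; omega)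
  · have e : vset [a, b, c, d] = a ∪ b ∪ c := by
      ext z
      rw [hv, Finset.mem_union, Finset.mem_union]
      have := D z
      tauto
    have f1 := Finset.card_union_add_card_inter a b
    have f2 := Finset.card_union_add_card_inter (a ∪ b) c
    have f3 : ((a ∪ b) ∩ c).card = 2 := by
      rw [Finset.union_inter_distrib_right, Finset.card_union_of_disjoint, ac, bc]
      rw [Finset.disjoint_left]
      intro z hz hz'
      rw [Finset.mem_inter] at hz hz'
      exact t1 z hz.1 hz'.1 hz.2
    rw [e]; omega
  · intro v hvv
    rw [hv] at hvv
    have A := A v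
    have B := B v
    have C := C v
    have D := D v
    have t1 := t1 v
    have t2 := t2 v
    have t3 := t3 v
    have t4 := t4 v
    rw [Finset.card_filter]
    simp only [Finset.sum_range_succ, Finset.sum_range_zero, List.getD_cons_zero,
      List.getD_cons_succ, zero_add]
    by_cases ha : v ∈ a <;> by_cases hb : v ∈ b <;> by_cases hc : v ∈ c <;> by_cases hd : v ∈ d <;>
      simp_all

theorem Closed'.mono {F F' : Finset (Finset V)} {g : Finset V} (h : F ⊆ F') (hc : Closed' F g) :
    Closed' F' g := by
  obtain ⟨x, hx, y, hy, hxy, hr⟩ := hc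
  exact ⟨x, hx, y, hy, hxy, hr.mono h⟩

/-- An extra edge inside a triangle of `3`-sets. -/
theorem tri_edge {a b c h : Finset V} (ch : h.card = 3) (ha : (h ∩ a).card ≤ 1)
    (hb : (h ∩ b).card ≤ 1) (hc : (h ∩ c).card ≤ 1) (hs : h ⊆ a ∪ b ∪ c) :
    (a ∩ h).card = 1 ∧ ∀ z, z ∈ a → z ∈ b → z ∉ h := by
  have hd : h.card ≤ (h ∩ a).card + (h ∩ b).card + (h ∩ c).card := by
    refine le_trans (Finset.card_le_card ?_) (le_trans (Finset.card_union_le (h ∩ a ∪ h ∩ b) (h ∩ c))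
      (Nat.add_le_add_right (Finset.card_union_le _ _) _))
    intro z hz
    have := hs hz
    simp only [Finset.mem_union, Finset.mem_inter] at this ⊢
    tauto
  refine ⟨by rw [Finset.inter_comm]; omega, ?_⟩
  intro z hza hzb hzh
  have : h.card ≤ (h ∩ a).card + (h ∩ c).card := by
    refine le_trans (Finset.card_le_card ?_) (Finset.card_union_le (h ∩ a) (h ∩ c))
    intro w hw
    have := hs hw
    simp only [Finset.mem_union, Finset.mem_inter] at this ⊢
    rcases this with (h1 | h1) | h1
    · exact Or.inl ⟨hw, h1⟩
    · have : w = z := eq_of_card_inter_le_one hb hw h1 hzh hzb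
      subst this
      exact Or.inl ⟨hw, hza⟩
    · exact Or.inr ⟨hw, h1⟩
  omega

theorem BF.case_pasch {E : Finset (Finset V)} (H : BF 3 E)
    (hlin : ∀ e ∈ E, ∀ f ∈ E, e ≠ f → (e ∩ f).card ≤ 1) {a b c h : Finset V}
    (hC : LooseCycle [a, b, c]) (hCE : ∀ e ∈ [a, b, c], e ∈ E)
    (t1 : ∀ z, z ∈ a → z ∈ b → z ∉ c) (hh : h ∈ E) (hhC : h ∉ [a, b, c])
    (hs : h ⊆ vset [a, b, c]) : Concl 3 E := by
  have ma := hCE a (by simp)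
  have mb := hCE b (by simp)
  have mc := hCE c (by simp)
  have ab : (a ∩ b).card = 1 := by simpa using hC.2.2 0 1 (by omega) (by simp)
  have bc : (b ∩ c).card = 1 := by simpa using hC.2.2 1 2 (by omega) (by simp)
  have ac : (a ∩ c).card = 1 := by simpa using hC.2.2 0 2 (by omega) (by simp)
  have hv : vset [a, b, c] = a ∪ b ∪ c := by
    simp [vset_cons, vset_nil]
  have key : ∀ g ∈ E, g ∉ [a, b, c] → g ⊆ vset [a, b, c] →
      (a ∩ g).card = 1 ∧ (b ∩ g).card = 1 ∧ (c ∩ g).card = 1 ∧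
      (∀ z, z ∈ a → z ∈ b → z ∉ g) ∧ (∀ z, z ∈ a → z ∈ c → z ∉ g) ∧
      (∀ z, z ∈ b → z ∈ c → z ∉ g) := by
    intro g hg hgC hgs
    rw [hv] at hgs
    simp only [List.mem_cons, List.not_mem_nil, or_false, not_or] at hgC
    have ga := hlin g hg a ma hgC.1
    have gb := hlin g hg b mb hgC.2.1
    have gc := hlin g hg c mc hgC.2.2
    have cg := H.hu g hg
    have r1 := tri_edge cg ga gb gc hgs
    have r2 := tri_edge (a := b) (b := c) (c := a) cg gb gc ga (by
      intro z hz; have := hgs hz; simp only [Finset.mem_union] at this ⊢; tauto)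
    have r3 := tri_edge (a := c) (b := a) (c := b) cg gc ga gb (by
      intro z hz; have := hgs hz; simp only [Finset.mem_union] at this ⊢; tauto)
    exact ⟨r1.1, r2.1, r3.1, r1.2, fun z h1 h2 => r3.2 z h2 h1, r2.2⟩
  obtain ⟨k1, k2, k3, k4, k5, k6⟩ := key h hh hhC hs
  have ca := H.hu a ma
  have cb := H.hu b mb
  have cc := H.hu c mc
  have ch := H.hu h hh
  have A := cover_of_three ca ab ac k1 t1 k4 k5
  have B := cover_of_three (a := b) (b := a) (c := c) (d := h) cb (by rw [Finset.inter_comm]; exact ab)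
    bc k2 (fun z h1 h2 => t1 z h2 h1) (fun z h1 h2 => k4 z h2 h1) k6
  have C := cover_of_three (a := c) (b := a) (c := b) (d := h) cc (by rw [Finset.inter_comm]; exact ac)
    (by rw [Finset.inter_comm]; exact bc) k3 (fun z h1 h2 h3 => t1 z h2 h3 h1)
    (fun z h1 h2 => k5 z h2 h1) (fun z h1 h2 => k6 z h2 h1)
  have uniq : ∀ g ∈ E, g ∉ [a, b, c] → g ⊆ vset [a, b, c] → g = h := by
    intro g hg hgC hgs
    obtain ⟨-, -, -, l4, l5, l6⟩ := key g hg hgC hgs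
    apply Finset.eq_of_subset_of_card_le _ (by rw [ch, H.hu g hg])
    intro z hz
    have h1 := hgs hz
    rw [hv] at h1
    rw [Finset.mem_union, Finset.mem_union] at h1
    rcases h1 with (h1 | h1) | h1
    · rcases A z h1 with h2 | h2 | h2
      · exact (l4 z h1 h2 hz).elim
      · exact (l5 z h1 h2 hz).elim
      · exact h2
    · rcases B z h1 with h2 | h2 | h2
      · exact (l4 z h2 h1 hz).elim
      · exact (l6 z h1 h2 hz).elim
      · exact h2
    · rcases C z h1 with h2 | h2 | h2
      · exact (l5 z h2 h1 hz).elim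
      · exact (l6 z h2 h1 hz).elim
      · exact h2
  have hnd : [a, b, c, h].Nodup := by
    have : ([a, b, c] ++ [h]).Nodup := by
      rw [List.nodup_append]
      refine ⟨hC.2.1, by simp, ?_⟩
      intro x hx y hy hxy
      rw [List.mem_singleton] at hy
      subst hy; subst hxy
      exact hhC hx
    exact this
  have hv' : vset [a, b, c, h] = vset [a, b, c] := by
    have := vset_append [a, b, c] [h]
    rw [show [a, b, c] ++ [h] = [a, b, c, h] from rfl] at this
    rw [this, vset_cons h, vset_nil, Finset.union_empty]
    exact Finset.union_eq_left.2 hs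
  obtain ⟨T, hT1, hT2, hT3⟩ := H.core (l0 := [a, b, c, h]) hnd (by simp)
    (by
      intro g hg
      simp only [List.mem_cons, List.not_mem_nil, or_false] at hg
      rcases hg with rfl | rfl | rfl | rfl <;> assumption)
    (by
      intro g hg hgl
      by_contra hcon
      rw [hv', Finset.inter_comm] at hcon
      have hgC : g ∉ [a, b, c] := by
        intro h1; apply hgl
        simp only [List.mem_cons, List.not_mem_nil, or_false] at h1 ⊢
        tauto
      have := uniq g hg hgC (H.handle (Or.inr hC) hCE hg hgC (by omega))
      apply hgl; rw [this]; simp)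
    (fun e he _ f hf _ hef => hlin e he f hf hef)
    (by
      intro s hs'
      rw [hv'] at hs'
      refine ⟨[a, b, c], Or.inr hC, ?_, hs'⟩
      intro e he
      simp only [List.mem_cons, List.not_mem_nil, or_false] at he ⊢
      tauto)
    (by
      intro P x y hP hp
      rw [hv'] at hp
      exact H.no_double_loose hC hCE (fun p hp => (hP p hp).1) hp)
  exact ⟨_, T, hT1, hT2, hT3, Or.inr (Or.inr (Or.inr (Or.inl ⟨rfl,
    pasch_of hnd ca cb cc ch ab ac k1 bc k2 k3 t1 k4 k5 k6⟩)))⟩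

theorem BF.case_linear {k : ℕ} {E : Finset (Finset V)} (H : BF k E) (hne : E.Nonempty)
    (hlin : ∀ e ∈ E, ∀ f ∈ E, e ≠ f → (e ∩ f).card ≤ 1) : Concl k E := by
  classical
  have hk := H.hk
  by_cases hcl : ∃ g ∈ E, Closed' (E.erase g) g
  swap
  · obtain ⟨e0, he0⟩ := hne
    push Not at hcl
    obtain ⟨T, h1, h2, h3⟩ := H.extend (l0 := [e0]) (by simp) (by simp) (by simpa using he0)
      (by
        have : E \ [e0].toFinset = E.erase e0 := by
          ext z; simp [and_comm]
        rw [this, vset_cons, vset_nil, Finset.union_empty]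
        exact hcl e0 he0)
      (by
        intro g hg hc
        refine hcl g (Finset.mem_sdiff.1 hg).1 (hc.mono ?_)
        exact Finset.erase_subset_erase _ Finset.sdiff_subset)
    exact ⟨[e0], T, h1, h2, h3, Or.inl rfl⟩
  have hex : ∃ m, ∃ g ∈ E, ∃ x y p, (x ∈ g ∧ y ∈ g ∧ x ≠ y) ∧ Ch (E.erase g) x y m p := by
    obtain ⟨g, hg, hc⟩ := hcl
    obtain ⟨m, x, y, p, h1, h2⟩ := hc.exists_ch
    exact ⟨m, g, hg, x, y, p, h1, h2⟩
  obtain ⟨g, hg, x, y, p, ⟨hx, hy, hxy⟩, hch⟩ := Nat.find_spec hex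
  have hmin : ∀ m' < Nat.find hex, ∀ g ∈ E, ∀ x y p, (x ∈ g ∧ y ∈ g ∧ x ≠ y) →
      ¬ Ch (E.erase g) x y m' p := fun m' hm' g hg x y p h1 h2 =>
    Nat.find_min hex hm' ⟨g, hg, x, y, p, h1, h2⟩
  set m := Nat.find hex with hm
  clear_value m
  have hpath : PathOn g (mkL p m) x y := pathOn_of_min
    (fun f hf => hlin g hg f (Finset.mem_of_mem_erase hf) (Finset.ne_of_mem_erase hf).symm)
    (fun e he f hf hef => hlin e (Finset.mem_of_mem_erase he) f (Finset.mem_of_mem_erase hf) hef)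
    hx hy hxy hch (fun m' hm' x' y' p' => hmin m' hm' g hg x' y' p')
  have hC := hpath.looseCycle
  have hCE : ∀ e ∈ g :: mkL p m, e ∈ E := by
    intro e he
    rcases List.mem_cons.1 he with rfl | he
    · exact hg
    · obtain ⟨i, hi, rfl⟩ := mem_mkL.1 he
      exact Finset.mem_of_mem_erase (hch.2.2.2.1 i hi)
  have hlen : (g :: mkL p m).length = m + 1 := by rw [List.length_cons, mkL_length]
  by_cases hh : ∃ h ∈ E, h ∉ g :: mkL p m ∧ 2 ≤ (h ∩ vset (g :: mkL p m)).card
  · obtain ⟨h, hhE, hhC, hh2⟩ := hh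
    have hs := H.handle (Or.inr hC) hCE hhE hhC hh2
    have hidx : ∀ u ∈ h, ∃ i, i < m + 1 ∧ u ∈ (g :: mkL p m).getD i ∅ := by
      intro u hu
      obtain ⟨i, hi, hui⟩ := mem_vset_getD.1 (hs hu)
      exact ⟨i, by omega, hui⟩
    choose! idx hidx1 hidx2 using hidx
    have hsep : ∀ u ∈ h, ∀ v ∈ h, u ≠ v → idx u ≠ idx v := by
      intro u hu v hv huv hi
      have mm := getD_mem_of_lt (l := g :: mkL p m) (i := idx u) (by rw [hlen]; exact hidx1 u hu)
      refine huv (eq_of_card_inter_le_one (hlin h hhE _ (hCE _ mm) ?_) hu (hidx2 u hu) hv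
        (hi ▸ hidx2 v hv))
      intro heq
      rw [← heq] at mm
      exact hhC mm
    have hdist : ∀ u ∈ h, ∀ v ∈ h, u ≠ v → idx u ≤ idx v → m ≤ idx v - idx u + 1 := by
      intro u hu v hv huv hle
      by_contra hlt
      have b1 := hidx1 u hu
      have b2 := hidx1 v hv
      refine hmin (idx v - idx u + 1) (by omega) h hhE u v
        (fun t => (g :: mkL p m).getD (t + idx u) ∅) ⟨hu, hv, huv⟩ ⟨by omega, ?_, ?_, ?_, ?_⟩
      · simpa using hidx2 u hu
      · have : idx v - idx u + 1 - 1 + idx u = idx v := by omega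
        simp only [this]; exact hidx2 v hv
      · intro i hi
        have mm := getD_mem_of_lt (l := g :: mkL p m) (i := i + idx u) (by omega)
        refine Finset.mem_erase.2 ⟨?_, hCE _ mm⟩
        intro heq
        have heq' : (g :: mkL p m).getD (i + idx u) ∅ = h := heq
        rw [heq'] at mm
        exact hhC mm
      · intro i hi
        have := hC.chain (i + idx u) (by omega)
        rw [show i + idx u + 1 = i + 1 + idx u by omega] at this
        exact this
    have hm2 : m = 2 := by
      have := hpath.2.1
      rw [mkL_length] at this
      have hc3 : 2 < h.card := by rw [H.hu h hhE]; omega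
      obtain ⟨u, v, w, hu, hv, hw, huv, huw, hvw⟩ := Finset.two_lt_card_iff.1 hc3
      have := hdist u hu v hv huv
      have := hdist v hv u hu huv.symm
      have := hdist u hu w hw huw
      have := hdist w hw u hu huw.symm
      have := hdist v hv w hw hvw
      have := hdist w hw v hv hvw.symm
      have := hsep u hu v hv huv
      have := hsep u hu w hw huw
      have := hsep v hv w hw hvw
      have := hidx1 u hu
      have := hidx1 v hv
      have := hidx1 w hw
      omega
    have hk3 : k = 3 := by
      have : h.card ≤ (Finset.range (m + 1)).card := by
        apply Finset.card_le_card_of_injOn idx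
        · intro u hu
          simp only [Finset.coe_range, Set.mem_Iio]
          exact hidx1 u hu
        · intro u hu v hv huv
          by_contra hne
          exact hsep u hu v hv hne huv
      rw [H.hu h hhE, Finset.card_range] at this
      omega
    clear hmin hm hex
    subst hm2
    subst hk3
    have hmk : mkL p 2 = [p 0, p 1] := by
      apply List.ext_getElem
      · rw [mkL_length]; rfl
      · intro i h1 h2
        have h3 : i < 2 := by simpa using h2
        rw [← List.getD_eq_getElem _ ∅, mkL_getD h3]
        interval_cases i <;> rfl
    rw [hmk] at hC hCE hhC hs hpath
    refine H.case_pasch hlin hC hCE ?_ hhE hhC hs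
    intro z h1 h2 h3
    have q1 := hpath.2.2.2.1
    have q2 := hpath.2.2.2.2.1
    simp only [List.getD_cons_zero, List.length_cons, List.length_nil, List.getD_cons_succ] at q1 q2
    have e1 : z ∈ ({x} : Finset V) := by rw [← q1]; exact Finset.mem_inter.2 ⟨h2, h1⟩
    have e2 : z ∈ ({y} : Finset V) := by rw [← q2]; exact Finset.mem_inter.2 ⟨h3, h1⟩
    rw [Finset.mem_singleton] at e1 e2
    exact hxy (e1.symm.trans e2)
  · obtain ⟨T, h1, h2, h3⟩ := H.core (l0 := g :: mkL p m) hC.2.1 (by simp) hCE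
      (by
        intro h hhE hhC
        by_contra hcon
        rw [Finset.inter_comm] at hcon
        exact hh ⟨h, hhE, hhC, by omega⟩)
      (fun e he _ f hf _ hef => hlin e he f hf hef)
      (fun s hs => ⟨_, Or.inr hC, fun e he => he, hs⟩)
      (fun P x y hP hp => H.no_double_loose hC hCE (fun p hp => (hP p hp).1) hp)
    exact ⟨_, T, h1, h2, h3, Or.inr (Or.inl hC)⟩

/-- Exchange the first centre for the second. -/
def psi (c₁ c₂ : V) (a : Finset V) : Finset V := insert c₂ (a.erase c₁)

/-- Every overlapping pair differs exactly in the two centres. -/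
structure TwoStar (E : Finset (Finset V)) (c₁ c₂ : V) : Prop where
  hc : c₁ ≠ c₂
  h1 : ∀ a b, IsOP E a b → c₁ ∈ a → c₂ ∉ a ∧ b = psi c₁ c₂ a
  h2 : ∀ a b, IsOP E a b → c₁ ∈ a ∨ c₁ ∈ b

theorem BF.star_aux {k : ℕ} {E : Finset (Finset V)} (H : BF k E) {e f a b : Finset V} {c₁ c₂ : V}
    (h : IsOP E e f) (h1 : c₁ ∈ e \ f) (h2 : c₂ ∈ f \ e) (hc : (e ∩ f).card = k - 1)
    (hab : IsOP E a b) (hU : a ∪ b ≠ e ∪ f) :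
    ((c₁ ∈ a \ b ∧ c₂ ∈ b \ a) ∨ (c₂ ∈ a \ b ∧ c₁ ∈ b \ a)) ∧ (a ∩ b).card = k - 1 := by
  have hk := H.hk
  obtain ⟨x, y, hxy, hi, hx, hy, hor, hc1, -⟩ := H.op_two hab h hU
  have s1 : (e \ f).card ≤ 1 := by
    have := Finset.card_sdiff_add_card_inter e f
    rw [H.hu _ h.1] at this; omega
  have s2 : (f \ e).card ≤ 1 := by
    have := Finset.card_sdiff_add_card_inter f e
    rw [H.hu _ h.2.1, Finset.inter_comm] at this; omega
  rw [Finset.card_le_one] at s1 s2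
  refine ⟨?_, hc1⟩
  rcases hor with ⟨q1, q2⟩ | ⟨q1, q2⟩
  · rw [s1 _ h1 _ q1, s2 _ h2 _ q2]; exact Or.inl ⟨hx, hy⟩
  · rw [s1 _ h1 _ q2, s2 _ h2 _ q1]; exact Or.inr ⟨hx, hy⟩

theorem BF.star_exists {k : ℕ} {E : Finset (Finset V)} (H : BF k E) {e f e' f' : Finset V}
    (h : IsOP E e f) (h' : IsOP E e' f') (hU : e ∪ f ≠ e' ∪ f') :
    ∃ c₁ c₂, TwoStar E c₁ c₂ := by
  have hk := H.hk
  obtain ⟨x, y, hxy, hi, hx, hy, hor, hc1, hc2⟩ := H.op_two h h' hU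
  have sd : ∀ a b, IsOP E a b →
      ((x ∈ a \ b ∧ y ∈ b \ a) ∨ (y ∈ a \ b ∧ x ∈ b \ a)) ∧ (a ∩ b).card = k - 1 := by
    intro a b hab
    by_cases c : a ∪ b = e ∪ f
    · rcases hor with ⟨q1, q2⟩ | ⟨q1, q2⟩
      · exact H.star_aux h' q1 q2 hc2 hab (by rw [c]; exact hU)
      · exact H.star_aux h'.symm q1 q2 (by rw [Finset.inter_comm]; exact hc2) hab
          (by rw [c, Finset.union_comm f']; exact hU)
    · exact H.star_aux h hx hy hc1 hab c
  refine ⟨x, y, hxy, ?_, ?_⟩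
  · intro a b hab hxa
    obtain ⟨q, qc⟩ := sd a b hab
    simp only [Finset.mem_sdiff] at q
    have q' : (x ∈ a ∧ x ∉ b) ∧ y ∈ b ∧ y ∉ a := by
      rcases q with q | q
      · exact q
      · exact (q.2.2 hxa).elim
    refine ⟨q'.2.2, ?_⟩
    have r1 : a ∩ b = a.erase x := by
      apply Finset.eq_of_subset_of_card_le
      · intro z hz
        rw [Finset.mem_inter] at hz
        refine Finset.mem_erase.2 ⟨?_, hz.1⟩
        rintro rfl; exact q'.1.2 hz.2
      · rw [Finset.card_erase_of_mem hxa, H.hu _ hab.1, qc]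
    have r2 : a ∩ b = b.erase y := by
      apply Finset.eq_of_subset_of_card_le
      · intro z hz
        rw [Finset.mem_inter] at hz
        refine Finset.mem_erase.2 ⟨?_, hz.2⟩
        rintro rfl; exact q'.2.2 hz.1
      · rw [Finset.card_erase_of_mem q'.2.1, H.hu _ hab.2.1, qc]
    rw [psi, ← r1, r2, Finset.insert_erase q'.2.1]
  · intro a b hab
    obtain ⟨q, -⟩ := sd a b hab
    simp only [Finset.mem_sdiff] at q
    tauto

theorem loosePath_cons {a : Finset V} {P : List (Finset V)} {x : V} (hP : LoosePath P)
    (ha : 2 ≤ a.card) (h0 : P.getD 0 ∅ ∩ a = {x})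
    (hi : ∀ i, 0 < i → i < P.length → P.getD i ∅ ∩ a = ∅) : LoosePath (a :: P) := by
  refine ⟨by simp, List.nodup_cons.2 ⟨?_, hP.2.1⟩, ?_⟩
  · intro haP
    obtain ⟨i, hil, hia⟩ := exists_getD_of_mem haP
    have : (P.getD i ∅ ∩ a).card ≤ 1 := by
      by_cases c : i = 0
      · subst c; rw [h0]; simp
      · rw [hi i (by omega) hil]; simp
    rw [hia, Finset.inter_self] at this
    omega
  · intro i j hij hj
    rw [List.length_cons] at hj
    obtain ⟨j, rfl⟩ : ∃ j', j = j' + 1 := ⟨j - 1, by omega⟩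
    rw [List.getD_cons_succ]
    by_cases c : i = 0
    · subst c
      rw [List.getD_cons_zero, Finset.inter_comm]
      by_cases d : j = 0
      · subst d; rw [h0, if_pos rfl]; simp
      · rw [hi j (by omega) (by omega), if_neg (by omega)]; simp
    · obtain ⟨i, rfl⟩ : ∃ i', i = i' + 1 := ⟨i - 1, by omega⟩
      rw [List.getD_cons_succ, hP.2.2 i j (by omega) (by omega)]
      congr 1
      rw [eq_iff_iff]
      omega

section star
variable {k : ℕ} {E : Finset (Finset V)} {c₁ c₂ : V}

/-- The edges of the first star. -/
def M1 (E : Finset (Finset V)) (c₁ c₂ : V) (a : Finset V) : Prop :=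
  c₁ ∈ a ∧ IsOP E a (psi c₁ c₂ a)

theorem TwoStar.c2 (S : TwoStar E c₁ c₂) {a : Finset V} (h : M1 E c₁ c₂ a) : c₂ ∉ a :=
  (S.h1 _ _ h.2 h.1).1

theorem TwoStar.c1_psi (S : TwoStar E c₁ c₂) {a : Finset V} : c₁ ∉ psi c₁ c₂ a := by
  rw [psi, Finset.mem_insert]
  rintro (h | h)
  · exact S.hc h
  · simp at h

theorem c2_psi {a : Finset V} : c₂ ∈ psi c₁ c₂ a := Finset.mem_insert_self _ _

theorem TwoStar.union (S : TwoStar E c₁ c₂) {a : Finset V} (h : M1 E c₁ c₂ a) :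
    a ∪ psi c₁ c₂ a = insert c₂ a := by
  ext z
  simp only [psi, Finset.mem_union, Finset.mem_insert, Finset.mem_erase]
  tauto

theorem TwoStar.of_op (S : TwoStar E c₁ c₂) {a b : Finset V} (h : IsOP E a b) :
    (M1 E c₁ c₂ a ∧ b = psi c₁ c₂ a) ∨ (M1 E c₁ c₂ b ∧ a = psi c₁ c₂ b) := by
  rcases S.h2 a b h with hc | hc
  · have := (S.h1 a b h hc).2
    exact Or.inl ⟨⟨hc, this ▸ h⟩, this⟩
  · have := (S.h1 b a h.symm hc).2
    exact Or.inr ⟨⟨hc, this ▸ h.symm⟩, this⟩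

theorem TwoStar.inj (S : TwoStar E c₁ c₂) {a b : Finset V} (ha : M1 E c₁ c₂ a) (hb : M1 E c₁ c₂ b)
    (h : insert c₂ a = insert c₂ b) : a = b := by
  have := congrArg (fun s => Finset.erase s c₂) h
  simpa [Finset.erase_insert (S.c2 ha), Finset.erase_insert (S.c2 hb)] using this

theorem TwoStar.inter (H : BF k E) (S : TwoStar E c₁ c₂) {a b : Finset V} (ha : M1 E c₁ c₂ a)
    (hb : M1 E c₁ c₂ b) (hab : a ≠ b) : insert c₂ a ∩ insert c₂ b = {c₁, c₂} := by
  obtain ⟨x, y, hxy, hi, hx, hy, -⟩ := H.op_two ha.2 hb.2 (by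
    rw [S.union ha, S.union hb]
    exact fun h => hab (S.inj ha hb h))
  have e1 : x = c₁ := by
    simp only [psi, Finset.mem_sdiff, Finset.mem_insert, Finset.mem_erase] at hx
    tauto
  have e2 : y = c₂ := by
    simp only [psi, Finset.mem_sdiff, Finset.mem_insert, Finset.mem_erase] at hy
    tauto
  rw [S.union ha, S.union hb, e1, e2] at hi
  exact hi

theorem TwoStar.inter1 (H : BF k E) (S : TwoStar E c₁ c₂) {a b : Finset V} (ha : M1 E c₁ c₂ a)
    (hb : M1 E c₁ c₂ b) (hab : a ≠ b) : a ∩ b = {c₁} := by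
  have h := S.inter H ha hb hab
  have h1 := S.c2 ha
  ext z
  rw [Finset.mem_inter, Finset.mem_singleton]
  constructor
  · rintro ⟨q1, q2⟩
    have : z ∈ insert c₂ a ∩ insert c₂ b := by simp [q1, q2]
    rw [h, Finset.mem_insert, Finset.mem_singleton] at this
    rcases this with q | q
    · exact q
    · exact (h1 (q ▸ q1)).elim
  · rintro rfl; exact ⟨ha.1, hb.1⟩

theorem TwoStar.inter2 (H : BF k E) (S : TwoStar E c₁ c₂) {a b : Finset V} (ha : M1 E c₁ c₂ a)
    (hb : M1 E c₁ c₂ b) (hab : a ≠ b) : psi c₁ c₂ a ∩ psi c₁ c₂ b = {c₂} := by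
  have h := S.inter1 H ha hb hab
  ext z
  simp only [psi, Finset.mem_inter, Finset.mem_singleton, Finset.mem_insert, Finset.mem_erase]
  constructor
  · rintro ⟨q1 | q1, q2 | q2⟩
    · exact q1
    · exact q1
    · exact q2
    · have : z ∈ a ∩ b := Finset.mem_inter.2 ⟨q1.2, q2.2⟩
      rw [h, Finset.mem_singleton] at this
      exact (q1.1 this).elim
  · rintro rfl; simp

theorem TwoStar.cyc (H : BF k E) (S : TwoStar E c₁ c₂) {a b : Finset V} (ha : M1 E c₁ c₂ a)
    (hb : M1 E c₁ c₂ b) (hab : a ≠ b) {P : List (Finset V)} {x y : V} (hP : LoosePath P)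
    (hPE : ∀ p ∈ P, p ∈ E) (hx : P.getD 0 ∅ ∩ a = {x})
    (hx' : ∀ i, 0 < i → i < P.length → P.getD i ∅ ∩ a = ∅)
    (hy : P.getD (P.length - 1) ∅ ∩ b = {y})
    (hy' : ∀ i, i + 1 < P.length → P.getD i ∅ ∩ b = ∅) (hyc : y ≠ c₁) (hc2 : c₂ ∉ vset P) :
    False := by
  have hk := H.hk
  have hlen : 0 < P.length := List.length_pos_of_ne_nil hP.1
  have hca := H.hu _ ha.2.1
  have hpath : PathOn b (a :: P) c₁ y := by
    refine ⟨loosePath_cons hP (by omega) hx hx', by rw [List.length_cons]; omega, hyc.symm, ?_, ?_, ?_⟩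
    · rw [List.getD_cons_zero]; exact S.inter1 H ha hb hab
    · rw [List.length_cons, Nat.add_sub_cancel]
      obtain ⟨n, hn⟩ : ∃ n, P.length = n + 1 := ⟨P.length - 1, by omega⟩
      rw [hn, List.getD_cons_succ]
      rw [hn] at hy
      exact hy
    · intro i hi hi'
      obtain ⟨i, rfl⟩ : ∃ i', i = i' + 1 := ⟨i - 1, by omega⟩
      rw [List.getD_cons_succ]
      rw [List.length_cons] at hi'
      exact hy' i (by omega)
  have hC := hpath.looseCycle
  have hsub : psi c₁ c₂ a ∩ a = a.erase c₁ := by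
    have := S.c2 ha
    ext z
    simp only [psi, Finset.mem_inter, Finset.mem_insert, Finset.mem_erase]
    constructor
    · rintro ⟨rfl | q, q'⟩
      · exact (this q').elim
      · exact q
    · rintro q; exact ⟨Or.inr q, q.2⟩
  have hcard : 2 ≤ (psi c₁ c₂ a ∩ a).card := by
    rw [hsub, Finset.card_erase_of_mem ha.1]; omega
  have hs : psi c₁ c₂ a ⊆ vset (b :: a :: P) := by
    refine H.handle (Or.inr hC) ?_ ha.2.2.1 ?_ ?_
    · intro e he
      rw [List.mem_cons, List.mem_cons] at he
      rcases he with rfl | rfl | he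
      · exact hb.2.1
      · exact ha.2.1
      · exact hPE e he
    · rw [List.mem_cons, List.mem_cons]
      rintro (q | q | q)
      · have := S.c1_psi (a := a)
        rw [q] at this
        exact this hb.1
      · have := S.c1_psi (a := a)
        rw [q] at this
        exact this ha.1
      · exact hc2 (subset_vset q c2_psi)
    · refine le_trans hcard (Finset.card_le_card ?_)
      apply Finset.inter_subset_inter_left
      exact subset_vset (by simp)
  have := hs c2_psi
  rw [vset_cons, vset_cons, Finset.mem_union, Finset.mem_union] at this
  rcases this with q | q | q
  · exact S.c2 hb q
  · exact S.c2 ha q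
  · exact hc2 q

theorem BF.case_star (H : BF k E) (S : TwoStar E c₁ c₂) {e e' : Finset V} (he : M1 E c₁ c₂ e)
    (he' : M1 E c₁ c₂ e') (hee : e ≠ e') : Concl k E := by
  classical
  have hk := H.hk
  set M := E.filter (M1 E c₁ c₂) with hM
  set l1 := M.toList with hl1
  have ml1 : ∀ a, a ∈ l1 ↔ M1 E c₁ c₂ a := by
    intro a
    rw [hl1, Finset.mem_toList, hM, Finset.mem_filter]
    exact ⟨fun h => h.2, fun h => ⟨h.2.1, h⟩⟩
  have ml2 : ∀ b, b ∈ l1.map (psi c₁ c₂) ↔ ∃ a, M1 E c₁ c₂ a ∧ psi c₁ c₂ a = b := by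
    intro b; rw [List.mem_map]; simp only [ml1]
  have nd1 : l1.Nodup := M.nodup_toList
  have psi_inj : ∀ a, M1 E c₁ c₂ a → ∀ b, M1 E c₁ c₂ b → psi c₁ c₂ a = psi c₁ c₂ b → a = b := by
    intro a ha b hb hab
    by_contra hne
    have := S.inter2 H ha hb hne
    rw [hab, Finset.inter_self] at this
    have h2 := H.hu _ hb.2.2.1
    rw [this] at h2
    simp at h2; omega
  have nd2 : (l1.map (psi c₁ c₂)).Nodup :=
    nd1.map_on (fun a ha b hb => psi_inj a ((ml1 a).1 ha) b ((ml1 b).1 hb))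
  have nd : (l1 ++ l1.map (psi c₁ c₂)).Nodup := by
    rw [List.nodup_append]
    refine ⟨nd1, nd2, ?_⟩
    rintro a ha b hb rfl
    obtain ⟨b, hb, hba⟩ := (ml2 a).1 hb
    have := ((ml1 a).1 ha).1
    rw [← hba] at this
    exact S.c1_psi this
  have ml : ∀ g, g ∈ l1 ++ l1.map (psi c₁ c₂) ↔ M1 E c₁ c₂ g ∨ ∃ a, M1 E c₁ c₂ a ∧ psi c₁ c₂ a = g := by
    intro g; rw [List.mem_append, ml1, ml2]
  have mop : ∀ a b, IsOP E a b → a ∈ l1 ++ l1.map (psi c₁ c₂) := by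
    intro a b hab
    rw [ml]
    rcases S.of_op hab with q | q
    · exact Or.inl q.1
    · exact Or.inr ⟨b, q.1, q.2.symm⟩
  have hsub : ∀ a, M1 E c₁ c₂ a → a ∪ psi c₁ c₂ a ⊆ vset (l1 ++ l1.map (psi c₁ c₂)) := by
    intro a ha
    apply Finset.union_subset
    · exact subset_vset ((ml _).2 (Or.inl ha))
    · exact subset_vset ((ml _).2 (Or.inr ⟨a, ha, rfl⟩))
  have mv : ∀ z, z ∈ vset (l1 ++ l1.map (psi c₁ c₂)) → ∃ a, M1 E c₁ c₂ a ∧ z ∈ a ∪ psi c₁ c₂ a := by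
    intro z hz
    obtain ⟨g, hg, hzg⟩ := mem_vset.1 hz
    rcases (ml g).1 hg with q | ⟨a, q, rfl⟩
    · exact ⟨g, q, Finset.mem_union_left _ hzg⟩
    · exact ⟨a, q, Finset.mem_union_right _ hzg⟩
  have c1U : ∀ a, M1 E c₁ c₂ a → c₁ ∈ a ∪ psi c₁ c₂ a := fun a ha => Finset.mem_union_left _ ha.1
  have c2U : ∀ a, M1 E c₁ c₂ a → c₂ ∈ a ∪ psi c₁ c₂ a := fun a ha => Finset.mem_union_right _ c2_psi
  have inA : ∀ a, M1 E c₁ c₂ a → ∀ z, z ∈ a ∪ psi c₁ c₂ a → z ≠ c₂ → z ∈ a := by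
    intro a ha z hz hzc
    rw [S.union ha, Finset.mem_insert] at hz
    exact hz.resolve_left hzc
  have out : ∀ g ∈ E, g ∉ l1 ++ l1.map (psi c₁ c₂) → ∀ a, M1 E c₁ c₂ a →
      (g ∩ (a ∪ psi c₁ c₂ a)).card ≤ 1 := by
    intro g hg hgl a ha
    apply H.op_out ha.2 hg
    intro hs
    have hga : g ≠ a := by rintro rfl; exact hgl ((ml _).2 (Or.inl ha))
    exact hgl (mop _ _ (H.op_link1 ha.2 hg hs hga).1.symm)
  obtain ⟨T, hT1, hT2, hT3⟩ := H.core (l0 := l1 ++ l1.map (psi c₁ c₂)) nd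
    (List.ne_nil_of_mem ((ml e).2 (Or.inl he)))
    (by
      intro g hg
      rcases (ml g).1 hg with q | ⟨a, q, rfl⟩
      · exact q.2.1
      · exact q.2.2.1)
    (by
      intro g hg hgl
      rw [Finset.inter_comm]
      rw [Finset.card_le_one]
      intro x hx y hy
      rw [Finset.mem_inter] at hx hy
      by_contra hxy
      obtain ⟨a, ha, hxa⟩ := mv x hx.2
      obtain ⟨b, hb, hyb⟩ := mv y hy.2
      have hya : y ∉ a ∪ psi c₁ c₂ a := fun hya =>
        hxy (eq_of_card_inter_le_one (out g hg hgl a ha) hx.1 hxa hy.1 hya)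
      have hxb : x ∉ b ∪ psi c₁ c₂ b := fun hxb =>
        hxy (eq_of_card_inter_le_one (out g hg hgl b hb) hx.1 hxb hy.1 hyb)
      have hab : a ≠ b := by rintro rfl; exact hxb hxa
      have hx2 : x ≠ c₂ := by rintro rfl; exact hxb (c2U b hb)
      have hy2 : y ≠ c₂ := by rintro rfl; exact hya (c2U a ha)
      have hy1 : y ≠ c₁ := by rintro rfl; exact hya (c1U a ha)
      have sing : ∀ a, M1 E c₁ c₂ a → ∀ z ∈ g, z ∈ a → g ∩ a = {z} := by
        intro a ha z hzg hza
        ext w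
        rw [Finset.mem_inter, Finset.mem_singleton]
        constructor
        · rintro ⟨q1, q2⟩
          exact eq_of_card_inter_le_one (out g hg hgl a ha) q1 (Finset.mem_union_left _ q2) hzg
            (Finset.mem_union_left _ hza)
        · rintro rfl; exact ⟨hzg, hza⟩
      refine S.cyc H (P := [g]) ha hb hab ⟨by simp, by simp, ?_⟩ (by simpa using hg)
        (x := x) (y := y) ?_ ?_ ?_ ?_ hy1 ?_
      · intro i j hij hj
        simp at hj; omega
      · exact sing a ha x hx.1 (inA a ha x hxa hx2)
      · intro i hi hi'
        simp at hi'; omega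
      · exact sing b hb y hy.1 (inA b hb y hyb hy2)
      · intro i hi'
        simp at hi'
      · rw [vset_cons, vset_nil, Finset.union_empty]
        intro hcg
        exact hx2 (eq_of_card_inter_le_one (out g hg hgl a ha) hx.1 hxa hcg (c2U a ha)))
    (by
      intro a ha hal b hb hbl hab
      by_contra hcon
      exact hal (mop a b ⟨ha, hb, hab, by omega⟩))
    (by
      intro s hs
      obtain ⟨a, ha, hsa⟩ := mv s hs
      refine ⟨[a, psi c₁ c₂ a], ha.2.oplc H, ?_, by rw [vset_pair]; exact hsa⟩
      intro g hg
      simp only [List.mem_cons, List.not_mem_nil, or_false] at hg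
      rcases hg with rfl | rfl
      · exact (ml _).2 (Or.inl ha)
      · exact (ml _).2 (Or.inr ⟨a, ha, rfl⟩))
    (by
      intro P x y hP hp
      have hPE : ∀ p ∈ P, p ∈ E := fun p hp => (hP p hp).1
      have hx := mem_of_inter_eq_singleton hp.2.2.2.1
      have hy := mem_of_inter_eq_singleton hp.2.2.2.2.1
      have hcom : ∀ a, M1 E c₁ c₂ a → x ∈ a ∪ psi c₁ c₂ a → y ∈ a ∪ psi c₁ c₂ a → False :=
        fun a ha hxa hya => H.link_core ha.2 hPE (hp.mono (hsub a ha) hxa hya)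
      obtain ⟨a, ha, hxa⟩ := mv x hx.2
      obtain ⟨b, hb, hyb⟩ := mv y hy.2
      have hya : y ∉ a ∪ psi c₁ c₂ a := fun hya => hcom a ha hxa hya
      have hxb : x ∉ b ∪ psi c₁ c₂ b := fun hxb => hcom b hb hxb hyb
      have hab : a ≠ b := by rintro rfl; exact hxb hxa
      have hx2 : x ≠ c₂ := by rintro rfl; exact hxb (c2U b hb)
      have hy2 : y ≠ c₂ := by rintro rfl; exact hya (c2U a ha)
      have hy1 : y ≠ c₁ := by rintro rfl; exact hya (c1U a ha)
      have hxa' := inA a ha x hxa hx2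
      have hyb' := inA b hb y hyb hy2
      have hav : a ⊆ vset (l1 ++ l1.map (psi c₁ c₂)) := Finset.subset_union_left.trans (hsub a ha)
      have hbv : b ⊆ vset (l1 ++ l1.map (psi c₁ c₂)) := Finset.subset_union_left.trans (hsub b hb)
      have restrict : ∀ (A : Finset V) (p : Finset V) (z : V),
          A ⊆ vset (l1 ++ l1.map (psi c₁ c₂)) → p ∩ vset (l1 ++ l1.map (psi c₁ c₂)) = {z} →
          p ∩ A ⊆ {z} := by
        intro A p z hA hp
        rw [← hp]
        exact Finset.inter_subset_inter_left hA
      have h2 := hp.2.1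
      refine S.cyc H ha hb hab hp.1 hPE (x := x) (y := y) ?_ ?_ ?_ ?_ hy1 ?_
      · apply Finset.Subset.antisymm (restrict a _ x hav hp.2.2.2.1)
        rw [Finset.singleton_subset_iff, Finset.mem_inter]
        exact ⟨hx.1, hxa'⟩
      · intro i hi hi'
        rw [Finset.eq_empty_iff_forall_notMem]
        intro z hz
        by_cases c : i + 1 < P.length
        · have := hp.2.2.2.2.2 i hi c
          rw [Finset.mem_inter] at hz
          exact not_of_inter_eq_empty this hz.1 (hav hz.2)
        · have hi2 : i = P.length - 1 := by omega
          rw [hi2] at hz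
          have := restrict a _ y hav hp.2.2.2.2.1 hz
          rw [Finset.mem_singleton] at this
          subst this
          exact hya (Finset.mem_union_left _ (Finset.mem_inter.1 hz).2)
      · apply Finset.Subset.antisymm (restrict b _ y hbv hp.2.2.2.2.1)
        rw [Finset.singleton_subset_iff, Finset.mem_inter]
        exact ⟨hy.1, hyb'⟩
      · intro i hi'
        rw [Finset.eq_empty_iff_forall_notMem]
        intro z hz
        by_cases c : 0 < i
        · have := hp.2.2.2.2.2 i c hi'
          rw [Finset.mem_inter] at hz
          exact not_of_inter_eq_empty this hz.1 (hbv hz.2)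
        · have hi2 : i = 0 := by omega
          rw [hi2] at hz
          have := restrict b _ x hbv hp.2.2.2.1 hz
          rw [Finset.mem_singleton] at this
          subst this
          exact hxb (Finset.mem_union_left _ (Finset.mem_inter.1 hz).2)
      · intro hc
        have : c₂ ∈ vset (l1 ++ l1.map (psi c₁ c₂)) ∩ vset P :=
          Finset.mem_inter.2 ⟨hsub a ha (c2U a ha), hc⟩
        rw [hp.inter, Finset.mem_insert, Finset.mem_singleton] at this
        rcases this with q | q
        · exact hx2 q.symm
        · exact hy2 q.symm)
  refine ⟨_, T, hT1, hT2, hT3, ?_⟩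
  right; right; right; right; left
  have hl1e : e ∈ l1 := (ml1 e).2 he
  have hl1e' : e' ∈ l1 := (ml1 e').2 he'
  have hu : 2 ≤ l1.length := by
    rw [hl1, Finset.length_toList]
    apply Finset.one_lt_card.2
    exact ⟨e, Finset.mem_toList.1 hl1e, e', Finset.mem_toList.1 hl1e', hee⟩
  have gmap : ∀ i < l1.length, (l1.map (psi c₁ c₂)).getD i ∅ = psi c₁ c₂ (l1.getD i ∅) := by
    intro i hi
    rw [List.getD_eq_getElem _ _ (by simpa using hi), List.getD_eq_getElem _ _ hi, List.getElem_map]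
  have gM : ∀ i < l1.length, M1 E c₁ c₂ (l1.getD i ∅) := fun i hi => (ml1 _).1 (getD_mem_of_lt hi)
  have gne : ∀ i j, i < j → j < l1.length → l1.getD i ∅ ≠ l1.getD j ∅ := by
    intro i j hij hj
    rw [List.getD_eq_getElem _ _ (by omega), List.getD_eq_getElem _ _ hj]
    intro hh
    have := (List.Nodup.getElem_inj_iff nd1).1 hh
    omega
  have hne1 : l1 ≠ [] := List.ne_nil_of_mem hl1e
  refine ⟨l1.length, hu, ⟨nd, ?_⟩, by simp; omega, c₁, c₂, l1, l1.map (psi c₁ c₂), S.hc, rfl,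
    by simp, List.Perm.refl _, ⟨hne1, nd1, fun a ha => ((ml1 a).1 ha).1, ?_⟩,
    ⟨by simpa using hne1, nd2, ?_, ?_⟩, ?_⟩
  · intro i hi hil
    rw [List.length_append, List.length_map] at hil
    apply Finset.card_pos.2
    by_cases c : i < l1.length
    · refine ⟨c₁, mem_oldOf.2 ⟨?_, 0, hi, by simp; omega, ?_⟩⟩
      · rw [List.getD_append _ _ _ _ c]; exact (gM i c).1
      · rw [List.getD_append _ _ _ _ (by omega)]; exact (gM 0 (by omega)).1
    · have hi2 : i - l1.length < l1.length := by omega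
      have hop := (gM _ hi2).2.2.2.2
      obtain ⟨z, hz⟩ := Finset.card_pos.1 (lt_of_lt_of_le Nat.zero_lt_two hop)
      rw [Finset.mem_inter] at hz
      refine ⟨z, mem_oldOf.2 ⟨?_, i - l1.length, by omega, by simp; omega, ?_⟩⟩
      · rw [List.getD_append_right _ _ _ _ (by omega), gmap _ hi2]; exact hz.2
      · rw [List.getD_append _ _ _ _ hi2]; exact hz.1
  · intro i j hij hj
    exact S.inter1 H (gM i (by omega)) (gM j hj) (gne i j hij hj)
  · intro b hb
    obtain ⟨a, -, rfl⟩ := (ml2 b).1 hb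
    exact c2_psi
  · intro i j hij hj
    rw [List.length_map] at hj
    rw [gmap i (by omega), gmap j hj]
    exact S.inter2 H (gM i (by omega)) (gM j hj) (gne i j hij hj)
  · intro i hi
    rw [gmap i hi, psi, Finset.erase_insert]
    intro hh
    exact S.c2 (gM i hi) (Finset.mem_of_mem_erase hh)

end star

theorem BF.concl {k : ℕ} {E : Finset (Finset V)} (H : BF k E) (hne : E.Nonempty) : Concl k E := by
  by_cases h0 : ∃ e f, IsOP E e f
  · obtain ⟨e, f, h⟩ := h0
    by_cases h1 : ∀ e' f', IsOP E e' f' → e' ∪ f' = e ∪ f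
    · exact H.case_link h h1
    · push Not at h1
      obtain ⟨e', f', h', hU⟩ := h1
      obtain ⟨c₁, c₂, S⟩ := H.star_exists h h' hU.symm
      have : ∀ {e f}, IsOP E e f → ∃ a, M1 E c₁ c₂ a ∧ a ∪ psi c₁ c₂ a = e ∪ f := by
        intro e f h
        rcases S.of_op h with ⟨q, rfl⟩ | ⟨q, rfl⟩
        · exact ⟨e, q, rfl⟩
        · exact ⟨f, q, Finset.union_comm _ _⟩
      obtain ⟨a, ha, hau⟩ := this h
      obtain ⟨b, hb, hbu⟩ := this h'
      refine H.case_star S ha hb ?_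
      rintro rfl
      exact hU (hbu.symm.trans hau)
  · push Not at h0
    refine H.case_linear hne ?_
    intro e he f hf hef
    by_contra hcon
    exact h0 e f ⟨he, hf, hef, by omega⟩

theorem pairs_of_idx {l : List (Finset V)} {R : ℕ → Prop}
    (h : ∀ i j, i < j → j < l.length → R (l.getD i ∅ ∩ l.getD j ∅).card) :
    ∀ e ∈ l, ∀ f ∈ l, e ≠ f → R (e ∩ f).card := by
  intro e he f hf hef
  obtain ⟨i, hi, rfl⟩ := exists_getD_of_mem he
  obtain ⟨j, hj, rfl⟩ := exists_getD_of_mem hf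
  rcases Nat.lt_trichotomy i j with c | c | c
  · exact h i j c hj
  · subst c; exact (hef rfl).elim
  · rw [Finset.inter_comm]; exact h j i c hi

theorem LooseCycle.pairs {l : List (Finset V)} (h : LooseCycle l) :
    ∀ e ∈ l, ∀ f ∈ l, e ≠ f → (e ∩ f).card ≤ 1 := by
  refine pairs_of_idx (R := fun n => n ≤ 1) ?_
  intro i j hij hj
  rw [h.2.2 i j hij hj]
  split_ifs <;> omega

theorem Pasch.pairs {l : List (Finset V)} (h : Pasch l) :
    ∀ e ∈ l, ∀ f ∈ l, e ≠ f → (e ∩ f).card ≤ 1 := by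
  refine pairs_of_idx (R := fun n => n ≤ 1) ?_
  intro i j hij hj
  rw [h.2.1] at hj
  rw [h.2.2.2.2 i j hij hj]

theorem KLink.pairs {k n d : ℕ} {l : List (Finset V)} (h : KLink k n d l) (hk : 3 ≤ k)
    (hu : ∀ e ∈ l, e.card = k) (hd : d ≤ k / 2) :
    ∀ e ∈ l, ∀ f ∈ l, e ≠ f → 2 ≤ (e ∩ f).card := by
  refine pairs_of_idx (R := fun n => 2 ≤ n) ?_
  intro i j hij hj
  have h1 := h.2.2.2 i j hij (by rw [← h.2.1]; exact hj)
  have h2 := Finset.card_union_add_card_inter (l.getD i ∅) (l.getD j ∅)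
  rw [hu _ (getD_mem_of_lt (by omega)), hu _ (getD_mem_of_lt hj)] at h2
  omega

theorem StarKU2.pairs {k u : ℕ} {l : List (Finset V)} (h : StarKU2 k u l) (hk : 3 ≤ k) (hu2 : 2 ≤ u)
    (hu : ∀ e ∈ l, e.card = k) :
    (∃ e ∈ l, ∃ f ∈ l, e ≠ f ∧ 2 ≤ (e ∩ f).card) ∧ (∃ e ∈ l, ∃ f ∈ l, e ≠ f ∧ (e ∩ f).card = 1) := by
  obtain ⟨ha, hlen, c₁, c₂, l₁, l₂, hc, hl1, hl2, hp, s1, s2, he⟩ := h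
  have hnd : (l₁ ++ l₂).Nodup := hp.nodup_iff.2 ha.1
  have m1 : ∀ e ∈ l₁, e ∈ l := fun e he => hp.mem_iff.1 (List.mem_append_left _ he)
  have m2 : ∀ e ∈ l₂, e ∈ l := fun e he => hp.mem_iff.1 (List.mem_append_right _ he)
  have a0 : l₁.getD 0 ∅ ∈ l₁ := getD_mem_of_lt (by omega)
  have a1 : l₁.getD 1 ∅ ∈ l₁ := getD_mem_of_lt (by omega)
  have b0 : l₂.getD 0 ∅ ∈ l₂ := getD_mem_of_lt (by omega)
  constructor
  · refine ⟨_, m1 _ a0, _, m2 _ b0, ?_, ?_⟩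
    · exact (List.nodup_append.1 hnd).2.2 _ a0 _ b0
    · have h1 : (l₁.getD 0 ∅).erase c₁ ⊆ l₁.getD 0 ∅ ∩ l₂.getD 0 ∅ := by
        intro z hz
        rw [Finset.mem_inter]
        refine ⟨Finset.mem_of_mem_erase hz, ?_⟩
        rw [he 0 (by omega)] at hz
        exact Finset.mem_of_mem_erase hz
      have h2 := Finset.card_le_card h1
      rw [Finset.card_erase_of_mem (s1.2.2.1 _ a0), hu _ (m1 _ a0)] at h2
      omega
  · have h1 := s1.2.2.2 0 1 (by omega) (by omega)
    refine ⟨_, m1 _ a0, _, m1 _ a1, ?_, by rw [h1]; simp⟩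
    intro heq
    rw [heq, Finset.inter_self] at h1
    have := hu _ (m1 _ a1)
    rw [h1] at this
    simp at this
    omega

theorem exUnique_six {A0 A1 A2 A3 A4 A5 : Prop} (h : A0 ∨ A1 ∨ A2 ∨ A3 ∨ A4 ∨ A5)
    (h0 : A0 → ¬ A1 ∧ ¬ A2 ∧ ¬ A3 ∧ ¬ A4 ∧ ¬ A5) (h1 : A1 → ¬ A2 ∧ ¬ A3 ∧ ¬ A4 ∧ ¬ A5)
    (h2 : A2 → ¬ A3 ∧ ¬ A4 ∧ ¬ A5) (h3 : A3 → ¬ A4 ∧ ¬ A5) (h4 : A4 → ¬ A5) :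
    ∃! c : Fin 6, ![A0, A1, A2, A3, A4, A5] c := by
  rcases h with h | h | h | h | h | h
  · refine ⟨0, h, ?_⟩
    intro c hc
    fin_cases c <;> simp at hc ⊢ <;> tauto
  · refine ⟨1, h, ?_⟩
    intro c hc
    fin_cases c <;> simp at hc ⊢ <;> tauto
  · refine ⟨2, h, ?_⟩
    intro c hc
    fin_cases c <;> simp at hc ⊢ <;> tauto
  · refine ⟨3, h, ?_⟩
    intro c hc
    fin_cases c <;> simp at hc ⊢ <;> tauto
  · refine ⟨4, h, ?_⟩
    intro c hc
    fin_cases c <;> simp at hc ⊢ <;> tauto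
  · refine ⟨5, h, ?_⟩
    intro c hc
    fin_cases c <;> simp at hc ⊢ <;> tauto

theorem alt_unique {k : ℕ} (hk : 3 ≤ k) {l : List (Finset V)} (hnd : l.Nodup)
    (hu : ∀ e ∈ l, e.card = k) (h : Alt k l) {a : ℕ} (ha : l.length = a + 1) :
    ∃! c : Fin 6, ![a = 0, 2 ≤ a ∧ LooseCycle l, a = 1 ∧ OverlapPair k l,
      a = 3 ∧ k = 3 ∧ Pasch l, 3 ≤ a ∧ Odd a ∧ StarKU2 k ((a + 1) / 2) l,
      2 ≤ a ∧ ∃ d ≤ k / a, KLink k (a + 1) d l] c := by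
  have two : 2 ≤ a → ∃ e ∈ l, ∃ f ∈ l, e ≠ f := by
    intro h2
    refine ⟨_, getD_mem_of_lt (l := l) (i := 0) (by omega), _,
      getD_mem_of_lt (l := l) (i := 1) (by omega), ?_⟩
    rw [List.getD_eq_getElem _ _ (by omega), List.getD_eq_getElem _ _ (by omega)]
    intro hh
    have := (List.Nodup.getElem_inj_iff hnd).1 hh
    omega
  have link : 2 ≤ a → (∃ d ≤ k / a, KLink k (a + 1) d l) →
      ∀ e ∈ l, ∀ f ∈ l, e ≠ f → 2 ≤ (e ∩ f).card := by
    rintro h2 ⟨d, hd, hl⟩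
    exact hl.pairs hk hu (hd.trans (Nat.div_le_div_left h2 (by omega)))
  have nolink : (∀ e ∈ l, ∀ f ∈ l, e ≠ f → (e ∩ f).card ≤ 1) →
      ¬ (2 ≤ a ∧ ∃ d ≤ k / a, KLink k (a + 1) d l) := by
    rintro h1 ⟨h2, h3⟩
    obtain ⟨e, he, f, hf, hef⟩ := two h2
    have := link h2 h3 e he f hf hef
    have := h1 e he f hf hef
    omega
  have nostar : (∀ e ∈ l, ∀ f ∈ l, e ≠ f → (e ∩ f).card ≤ 1) →
      ¬ (3 ≤ a ∧ Odd a ∧ StarKU2 k ((a + 1) / 2) l) := by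
    rintro h1 ⟨h2, -, h3⟩
    obtain ⟨⟨e, he, f, hf, hef, hc⟩, -⟩ := h3.pairs hk (by omega) hu
    have := h1 e he f hf hef
    omega
  apply exUnique_six
  · rcases h with h | h | h | h | h | h
    · left; omega
    · right; left
      have := h.1
      exact ⟨by omega, h⟩
    · right; right; left
      refine ⟨?_, h⟩
      obtain ⟨e, f, rfl, -⟩ := h
      simp at ha; omega
    · right; right; right; left
      have := h.2.2.1
      exact ⟨by omega, h⟩
    · right; right; right; right; left
      obtain ⟨u, hu2, h⟩ := h
      have := h.2.1
      refine ⟨by omega, ⟨u - 1, by omega⟩, ?_⟩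
      rw [show (a + 1) / 2 = u by omega]
      exact h
    · right; right; right; right; right
      rw [ha, Nat.add_sub_cancel] at h
      exact ⟨by omega, h.2⟩
  · intro h0
    refine ⟨?_, ?_, ?_, ?_, ?_⟩ <;> intro hh <;> have := hh.1 <;> omega
  · rintro ⟨h1, h2⟩
    refine ⟨?_, ?_, nostar h2.pairs, nolink h2.pairs⟩
    · intro hh; have := hh.1; omega
    · rintro ⟨h3, -, h4⟩
      have q1 := h4.2.2.2.2 0 2 (by omega) (by omega)
      rw [h2.2.2 0 2 (by omega) (by omega), if_neg (by omega)] at q1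
      omega
  · rintro ⟨h1, -⟩
    refine ⟨?_, ?_, ?_⟩ <;> intro hh <;> have := hh.1 <;> omega
  · rintro ⟨h1, -, h2⟩
    exact ⟨nostar h2.pairs, nolink h2.pairs⟩
  · rintro ⟨h1, -, h2⟩ ⟨h3, h4⟩
    obtain ⟨-, ⟨e, he, f, hf, hef, hc⟩⟩ := h2.pairs hk (by omega) hu
    have := link h3 h4 e he f hf hef
    omega


/-- Lemma 3.3 of the paper. A finite connected `k`-uniform hypergraph
containing no bicycle has an edge order `e_0,…,e_t` such that for some `a`, every `e_i`
with `a+1 ≤ i ≤ t` is good, and precisely one of the six listed structural alternatives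
holds for `e_0,…,e_a`. -/
theorem structure_of_bicycle_free {V : Type*} [DecidableEq V] {k : ℕ} (hk : 3 ≤ k)
    (E : Finset (Finset V)) (hne : E.Nonempty) (hunif : Uniform k E)
    (hconn : HyperConnected E) (hnob : ¬ ContainsBicycle k E) :
    ∃ l : List (Finset V), l.Nodup ∧ l.toFinset = E ∧
      ∃ a, a < l.length ∧
        (∀ i, a + 1 ≤ i → i < l.length → GoodAt l i) ∧
        (∃! c : Fin 6,
          ![a = 0,
            2 ≤ a ∧ LooseCycle (l.take (a + 1)),
            a = 1 ∧ OverlapPair k (l.take 2),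
            a = 3 ∧ k = 3 ∧ Pasch (l.take 4),
            3 ≤ a ∧ Odd a ∧ StarKU2 k ((a + 1) / 2) (l.take (a + 1)),
            2 ≤ a ∧ ∃ d ≤ k / a, KLink k (a + 1) d (l.take (a + 1))] c) := by
  have H : BF k E := ⟨hk, hunif, hconn, hnob⟩
  obtain ⟨l0, T, h1, h2, h3, h4⟩ := H.concl hne
  have hpos : 0 < l0.length := by
    rcases h4 with h | h | h | h | h | h
    · omega
    · have := h.1; omega
    · obtain ⟨e, f, rfl, -⟩ := h
      simp
    · have := h.2.2.1; omega
    · obtain ⟨u, hu, h⟩ := h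
      have := h.2.1; omega
    · omega
  obtain ⟨a, ha⟩ : ∃ a, l0.length = a + 1 := ⟨l0.length - 1, by omega⟩
  have hmem : ∀ e ∈ l0, e.card = k := by
    intro e he
    apply hunif
    rw [← h2, List.mem_toFinset]
    exact List.mem_append_left _ he
  have htake : (l0 ++ T).take (a + 1) = l0 := by
    rw [← ha]; exact List.take_left
  refine ⟨l0 ++ T, h1, h2, a, by rw [List.length_append]; omega, ?_, ?_⟩
  · intro i hi hil
    exact h3 i (by omega) hil
  · have key := alt_unique hk (List.nodup_append.1 h1).1 hmem h4 ha
    have e2 : (a = 1 ∧ OverlapPair k ((l0 ++ T).take 2)) = (a = 1 ∧ OverlapPair k l0) := by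
      apply propext
      apply and_congr_right
      rintro rfl
      rw [htake]
    have e4 : (a = 3 ∧ k = 3 ∧ Pasch ((l0 ++ T).take 4)) = (a = 3 ∧ k = 3 ∧ Pasch l0) := by
      apply propext
      apply and_congr_right
      rintro rfl
      rw [htake]
    rw [e2, e4, htake]
    exact key
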